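/- arXiv:2404.08921 — 4 statements merged into one kernel-verified Lean document; each statement's English description precedes it below -/
import Mathlib

section
/- For every max-min string g of length L ≥ 1 on d_in input variables and d_out output variables, and for every compact set K ⊆ ℝ^{d_in}, there exists a ReLU network N with input dimension d_in, output dimension d_out, all hidden widths equal to d_in + d_out, and depth L, such that N(x) = g(x) for every x ∈ K. -/
open scoped ENNReal

noncomputable section

/-- Componentwise ReLU. -/
def relu {n : ℕ} (x : Fin n → ℝ) : Fin n → ℝ := fun i => max 0 (x i)

/-- A ReLU network `N = A_L ∘ ReLU ∘ A_{L-1} ∘ ⋯ ∘ ReLU ∘ A_1` with input dimension `din`,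
output dimension `dout`, depth `depth` and layer dimensions `dims`. -/
structure ReLUNet (din dout : ℕ) where
  depth : ℕ
  depth_pos : 0 < depth
  dims : Fin (depth + 1) → ℕ
  dims_zero : dims ⟨0, Nat.succ_pos depth⟩ = din
  dims_last : dims ⟨depth, Nat.lt_succ_self depth⟩ = dout
  weight : ∀ l : Fin depth, Matrix (Fin (dims l.succ)) (Fin (dims l.castSucc)) ℝ
  bias : ∀ l : Fin depth, Fin (dims l.succ) → ℝ

namespace ReLUNet

variable {din dout : ℕ}

/-- The pre-activation output of layer `k+1` (affine layers interleaved with ReLU). -/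
def preact (N : ReLUNet din dout) :
    (k : ℕ) → (hk : k < N.depth) → (Fin din → ℝ) →
      (Fin (N.dims ⟨k + 1, Nat.succ_lt_succ hk⟩) → ℝ)
  | 0, hk, x =>
      (N.weight ⟨0, hk⟩).mulVec (fun j => x (Fin.cast N.dims_zero j)) + N.bias ⟨0, hk⟩
  | k + 1, hk, x =>
      (N.weight ⟨k + 1, hk⟩).mulVec (relu (N.preact k (Nat.lt_of_succ_lt hk) x))
        + N.bias ⟨k + 1, hk⟩

theorem last_dim (N : ReLUNet din dout) :
    N.dims ⟨N.depth - 1 + 1, Nat.succ_lt_succ (Nat.sub_lt N.depth_pos Nat.one_pos)⟩ = dout := by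
  have hd := N.depth_pos
  have h : (⟨N.depth - 1 + 1, Nat.succ_lt_succ (Nat.sub_lt N.depth_pos Nat.one_pos)⟩ :
      Fin (N.depth + 1)) = ⟨N.depth, Nat.lt_succ_self N.depth⟩ := by
    apply Fin.ext; simp only; omega
  rw [h, N.dims_last]

/-- The function computed by the network. -/
def eval (N : ReLUNet din dout) (x : Fin din → ℝ) : Fin dout → ℝ :=
  fun i => N.preact (N.depth - 1) (Nat.sub_lt N.depth_pos Nat.one_pos) x
    (Fin.cast N.last_dim.symm i)

/-- The function computed by the network, as a map between Euclidean spaces. -/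
def evalE (N : ReLUNet din dout) (x : EuclideanSpace ℝ (Fin din)) :
    EuclideanSpace ℝ (Fin dout) :=
  (WithLp.equiv 2 (Fin dout → ℝ)).symm (N.eval ((WithLp.equiv 2 (Fin din → ℝ)) x))

/-- The width of the network: the maximum of the hidden layer dimensions `d_1, …, d_{L-1}`. -/
def width (N : ReLUNet din dout) : ℕ :=
  Finset.univ.sup fun l : Fin (N.depth + 1) =>
    if 0 < (l : ℕ) ∧ (l : ℕ) < N.depth then N.dims l else 0

/-- The parameter count `Σ_{l=1}^{L} d_l · d_{l-1}` of the network. -/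
def params (N : ReLUNet din dout) : ℕ :=
  ∑ l : Fin N.depth, N.dims l.succ * N.dims l.castSucc

end ReLUNet

/-- Identification of `ℝ^n` (as a Euclidean space) with plain functions. -/
def ofEuc {n : ℕ} (x : EuclideanSpace ℝ (Fin n)) : Fin n → ℝ :=
  (WithLp.equiv 2 (Fin n → ℝ)) x

/-- Identification of plain functions with `ℝ^n` (as a Euclidean space). -/
def toEuc {n : ℕ} (x : Fin n → ℝ) : EuclideanSpace ℝ (Fin n) :=
  (WithLp.equiv 2 (Fin n → ℝ)).symm x

/-- The modulus of continuity `ω_f(δ) = sup {‖f x - f y‖ : x, y ∈ Ω, ‖x - y‖ ≤ δ}`. -/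
def modulus {E F : Type*} [NormedAddCommGroup E] [NormedAddCommGroup F]
    (f : E → F) (Ω : Set E) (δ : ℝ) : ℝ :=
  sSup {r : ℝ | ∃ x ∈ Ω, ∃ y ∈ Ω, ‖x - y‖ ≤ δ ∧ r = ‖f x - f y‖}

/-- The dual modulus of continuity `ω_f⁻¹(ε) = sup {δ ≥ 0 : ω_f(δ) ≤ ε}` (as an
extended nonnegative real, so that the supremum is always meaningful). -/
def dualModulus {E F : Type*} [NormedAddCommGroup E] [NormedAddCommGroup F]
    (f : E → F) (Ω : Set E) (ε : ℝ) : ℝ≥0∞ :=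
  ⨆ δ ∈ {δ : ℝ | 0 ≤ δ ∧ modulus f Ω δ ≤ ε}, ENNReal.ofReal δ


/-- `f` is an affine map `ℝ^n → ℝ^m`. -/
def IsAffineMap {n m : ℕ} (f : (Fin n → ℝ) → (Fin m → ℝ)) : Prop :=
  ∃ (A : Matrix (Fin m) (Fin n) ℝ) (b : Fin m → ℝ), ∀ x, f x = A.mulVec x + b

/-- `IsMaxMinString din dout L g` : `g` is a max-min string of length `L` on `din`
input variables and `dout` output variables, i.e. it is built from `L` affine maps
`ℝ^{din} → ℝ^{dout}` combined successively by componentwise maxima or minima. -/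
inductive IsMaxMinString (din dout : ℕ) : ℕ → ((Fin din → ℝ) → (Fin dout → ℝ)) → Prop
  | affine (f : (Fin din → ℝ) → (Fin dout → ℝ)) (hf : IsAffineMap f) :
      IsMaxMinString din dout 1 f
  | max {L : ℕ} {g : (Fin din → ℝ) → (Fin dout → ℝ)} (hg : IsMaxMinString din dout L g)
      (ℓ : (Fin din → ℝ) → (Fin dout → ℝ)) (hℓ : IsAffineMap ℓ) :
      IsMaxMinString din dout (L + 1) (fun x i => max (ℓ x i) (g x i))
  | min {L : ℕ} {g : (Fin din → ℝ) → (Fin dout → ℝ)} (hg : IsMaxMinString din dout L g)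
      (ℓ : (Fin din → ℝ) → (Fin dout → ℝ)) (hℓ : IsAffineMap ℓ) :
      IsMaxMinString din dout (L + 1) (fun x i => min (ℓ x i) (g x i))

/-- `g` is a composition of finitely many ReLU residual blocks
`x ↦ x + v * max 0 (uᵀ x + b)` on `ℝ^d`. -/
inductive IsResNetCore (d : ℕ) : ((Fin d → ℝ) → (Fin d → ℝ)) → Prop
  | id : IsResNetCore d (fun x => x)
  | step {g : (Fin d → ℝ) → (Fin d → ℝ)} (hg : IsResNetCore d g) (u v : Fin d → ℝ) (b : ℝ) :
      IsResNetCore d (fun x => g x + fun i => v i * max 0 ((∑ j, u j * g x j) + b))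

/-- `R` is a ReLU residual network with one neuron per hidden layer:
a composition of residual blocks followed by a final affine map `ℝ^d → ℝ`. -/
def IsResNet1 (d : ℕ) (R : (Fin d → ℝ) → ℝ) : Prop :=
  ∃ g : (Fin d → ℝ) → (Fin d → ℝ), IsResNetCore d g ∧
    ∃ (a : Fin d → ℝ) (c : ℝ), ∀ x, R x = (∑ i, a i * g x i) + c


/-- Scalar-valued affine functions. -/
def AffOne {n : ℕ} (h : (Fin n → ℝ) → ℝ) : Prop :=
  ∃ (a : Fin n → ℝ) (b : ℝ), ∀ x, h x = (∑ j, a j * x j) + b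

theorem isAffineMap_iff {n m : ℕ} (f : (Fin n → ℝ) → (Fin m → ℝ)) :
    IsAffineMap f ↔ ∀ i, AffOne (fun x => f x i) := by
  constructor
  · rintro ⟨A, b, h⟩ i
    refine ⟨A i, b i, fun x => ?_⟩
    simp [h, Matrix.mulVec, dotProduct]
  · intro h
    choose a b hab using h
    refine ⟨a, b, fun x => ?_⟩
    funext i
    simp [hab, Matrix.mulVec, dotProduct]

theorem AffOne.const {n : ℕ} (c : ℝ) : AffOne (fun _ : Fin n → ℝ => c) :=
  ⟨0, c, by simp⟩

theorem AffOne.coord {n : ℕ} (i : Fin n) : AffOne (fun x : Fin n → ℝ => x i) :=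
  ⟨Pi.single i 1, 0, fun x => by simp [Pi.single_apply]⟩

theorem AffOne.add {n : ℕ} {f g : (Fin n → ℝ) → ℝ} (hf : AffOne f) (hg : AffOne g) :
    AffOne (fun x => f x + g x) := by
  obtain ⟨a, b, h⟩ := hf
  obtain ⟨a', b', h'⟩ := hg
  refine ⟨a + a', b + b', fun x => ?_⟩
  simp only [h, h', Pi.add_apply, add_mul, Finset.sum_add_distrib]
  ring

theorem AffOne.smul {n : ℕ} {f : (Fin n → ℝ) → ℝ} (c : ℝ) (hf : AffOne f) :
    AffOne (fun x => c * f x) := by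
  obtain ⟨a, b, h⟩ := hf
  refine ⟨fun j => c * a j, c * b, fun x => ?_⟩
  simp only [h, mul_add, Finset.mul_sum, mul_assoc]

theorem AffOne.sub {n : ℕ} {f g : (Fin n → ℝ) → ℝ} (hf : AffOne f) (hg : AffOne g) :
    AffOne (fun x => f x - g x) := by
  have := hf.add (hg.smul (-1))
  refine (congrArg AffOne ?_).mp this
  funext x
  ring

theorem AffOne.sum {n m : ℕ} {f : Fin m → (Fin n → ℝ) → ℝ} (hf : ∀ j, AffOne (f j)) :
    AffOne (fun x => ∑ j, f j x) := by
  choose a b h using hf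
  refine ⟨fun i => ∑ j, a j i, ∑ j, b j, fun x => ?_⟩
  simp only [h, Finset.sum_add_distrib, Finset.sum_mul]
  rw [Finset.sum_comm]

theorem AffOne.comp {n m : ℕ} {h : (Fin m → ℝ) → ℝ} {f : (Fin n → ℝ) → (Fin m → ℝ)}
    (hh : AffOne h) (hf : ∀ i, AffOne (fun x => f x i)) : AffOne (fun x => h (f x)) := by
  obtain ⟨a, b, e⟩ := hh
  simp only [e]
  exact (AffOne.sum fun j => (hf j).smul (a j)).add (AffOne.const b)

/-- Functions computed by `k` hidden layers of width `D` and a final affine map. -/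
inductive Hid (din D : ℕ) : ℕ → (m : ℕ) → ((Fin din → ℝ) → (Fin m → ℝ)) → Prop
  | zero {m : ℕ} (f : (Fin din → ℝ) → (Fin m → ℝ)) (hf : IsAffineMap f) : Hid din D 0 m f
  | succ {k m : ℕ} (f : (Fin din → ℝ) → (Fin D → ℝ)) (hf : Hid din D k D f)
      (A : (Fin D → ℝ) → (Fin m → ℝ)) (hA : IsAffineMap A) :
      Hid din D (k + 1) m (fun x => A (relu (f x)))

/-- Network evaluation with untyped indices. -/
def rawEval (w : ℕ → ℕ → ℕ → ℝ) (b : ℕ → ℕ → ℝ) (din D : ℕ) :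
    ℕ → (Fin din → ℝ) → ℕ → ℝ
  | 0, x, i => (∑ j : Fin din, w 0 i j * x j) + b 0 i
  | k + 1, x, i => (∑ j : Fin D, w (k + 1) i j * max 0 (rawEval w b din D k x j)) + b (k + 1) i

theorem rawEval_congr (w w' : ℕ → ℕ → ℕ → ℝ) (b b' : ℕ → ℕ → ℝ) (din D k : ℕ)
    (hw : ∀ l ≤ k, w l = w' l) (hb : ∀ l ≤ k, b l = b' l) :
    rawEval w b din D k = rawEval w' b' din D k := by
  induction k with
  | zero =>
    funext x i
    simp [rawEval, hw 0 le_rfl, hb 0 le_rfl]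
  | succ k ih =>
    have := ih (fun l hl => hw l (by omega)) (fun l hl => hb l (by omega))
    funext x i
    simp [rawEval, hw (k + 1) le_rfl, hb (k + 1) le_rfl, this]

/-- Extend a finite matrix by zero. -/
def extM {m n : ℕ} (A : Matrix (Fin m) (Fin n) ℝ) (i j : ℕ) : ℝ :=
  if h : i < m ∧ j < n then A ⟨i, h.1⟩ ⟨j, h.2⟩ else 0

/-- Extend a finite vector by zero. -/
def extV {m : ℕ} (b : Fin m → ℝ) (i : ℕ) : ℝ := if h : i < m then b ⟨i, h⟩ else 0

theorem Hid.exists_raw {din D k m : ℕ} {f : (Fin din → ℝ) → (Fin m → ℝ)}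
    (hf : Hid din D k m f) :
    ∃ w b, ∀ x (i : Fin m), f x i = rawEval w b din D k x i := by
  induction hf with
  | zero f hf =>
    obtain ⟨A, b, h⟩ := hf
    refine ⟨fun _ => extM A, fun _ => extV b, fun x i => ?_⟩
    simp [rawEval, h, extM, extV, Matrix.mulVec, dotProduct]
  | @succ k m f hf A hA ih =>
    obtain ⟨w, b, ih⟩ := ih
    obtain ⟨M, c, h⟩ := hA
    refine ⟨Function.update w (k + 1) (extM M), Function.update b (k + 1) (extV c),
      fun x i => ?_⟩
    have e : rawEval (Function.update w (k + 1) (extM M)) (Function.update b (k + 1) (extV c))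
        din D k = rawEval w b din D k := by
      apply rawEval_congr
      · intro l hl
        rw [Function.update_of_ne (by omega)]
      · intro l hl
        rw [Function.update_of_ne (by omega)]
    simp [rawEval, h, e, extM, extV, Matrix.mulVec, dotProduct, relu, ih]

/-- The layer dimensions. -/
def netDims (din D m k l : ℕ) : ℕ := if l = 0 then din else if l < k + 1 then D else m

/-- The network with given raw weights. -/
def mkNet (w : ℕ → ℕ → ℕ → ℝ) (b : ℕ → ℕ → ℝ) (din D m k : ℕ) : ReLUNet din m where
  depth := k + 1
  depth_pos := Nat.succ_pos k
  dims := fun l => netDims din D m k l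
  dims_zero := by simp [netDims]
  dims_last := by simp [netDims]
  weight := fun l i j => w l i j
  bias := fun l i => b l i

theorem sum_cast_aux {n n' : ℕ} (h : n = n') (W : ℕ → ℝ) (x : Fin n' → ℝ) :
    ∑ j : Fin n, W j * x (Fin.cast h j) = ∑ j : Fin n', W j * x j := by
  subst h
  rfl

theorem mkNet_preact (w : ℕ → ℕ → ℕ → ℝ) (b : ℕ → ℕ → ℝ) (din D m k : ℕ) (l : ℕ)
    (hl : l < (mkNet w b din D m k).depth) (x : Fin din → ℝ) (i) :
    (mkNet w b din D m k).preact l hl x i = rawEval w b din D l x i := by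
  induction l with
  | zero =>
    simp only [ReLUNet.preact, rawEval, Pi.add_apply, Matrix.mulVec, dotProduct]
    congr 1
  | succ l ih =>
    simp only [ReLUNet.preact, rawEval, Pi.add_apply, Matrix.mulVec, dotProduct, relu, ih]
    congr 1
    have hd : netDims din D m k (l + 1) = D := by
      have : l + 1 < k + 1 := hl
      simp [netDims, this]
    exact sum_cast_aux hd (fun j => w (l + 1) i j)
      (fun j => max 0 (rawEval w b din D l x j))

theorem Hid.exists_net {din D k m : ℕ} {f : (Fin din → ℝ) → (Fin m → ℝ)}
    (hf : Hid din D k m f) :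
    ∃ N : ReLUNet din m, N.depth = k + 1 ∧
      (∀ l : Fin (N.depth + 1), 0 < (l : ℕ) → (l : ℕ) < N.depth → N.dims l = D) ∧
      ∀ x, N.eval x = f x := by
  obtain ⟨w, b, h⟩ := hf.exists_raw
  refine ⟨mkNet w b din D m k, rfl, fun l h0 h1 => ?_, fun x => ?_⟩
  · have h2 : (l : ℕ) < k + 1 := h1
    change netDims din D m k l = D
    simp only [netDims, if_neg h0.ne', if_pos h2]
  · funext i
    rw [h, ReLUNet.eval, mkNet_preact]
    rfl

theorem string_hid {din dout n : ℕ} {g : (Fin din → ℝ) → (Fin dout → ℝ)}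
    (hg : IsMaxMinString din dout n g) (K : Set (Fin din → ℝ)) (c : ℝ)
    (hc : ∀ x ∈ K, ∀ i, 0 ≤ x i + c) :
    ∃ k, n = k + 1 ∧ ∀ (m : ℕ) (E : (Fin (din + dout) → ℝ) → (Fin m → ℝ)), IsAffineMap E →
      ∃ f, Hid din (din + dout) k m f ∧ ∀ x ∈ K, f x = E (Fin.append x (g x)) := by
  -- the common inductive step, with sign `s`
  have step : ∀ (s : ℝ) (k : ℕ) (g ℓ : (Fin din → ℝ) → (Fin dout → ℝ)), IsAffineMap ℓ →
      (∀ (m : ℕ) (E : (Fin (din + dout) → ℝ) → (Fin m → ℝ)), IsAffineMap E →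
        ∃ f, Hid din (din + dout) k m f ∧ ∀ x ∈ K, f x = E (Fin.append x (g x))) →
      (∀ (m : ℕ) (E : (Fin (din + dout) → ℝ) → (Fin m → ℝ)), IsAffineMap E →
        ∃ f, Hid din (din + dout) (k + 1) m f ∧ ∀ x ∈ K,
          f x = E (Fin.append x (fun i => ℓ x i + s * max 0 (s * (g x i - ℓ x i))))) := by
    intro s k g ℓ hℓ ih m E hE
    rw [isAffineMap_iff] at hℓ hE
    let P : (Fin (din + dout) → ℝ) → (Fin (din + dout) → ℝ) := fun z =>
      Fin.append (fun i => z (Fin.castAdd dout i) + c)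
        (fun i => s * (z (Fin.natAdd din i) - ℓ (fun j => z (Fin.castAdd dout j)) i))
    have hP : IsAffineMap P := by
      rw [isAffineMap_iff]
      intro i
      refine Fin.addCases (fun i => ?_) (fun i => ?_) i
      · simp only [P, Fin.append_left]
        exact (AffOne.coord _).add (AffOne.const c)
      · simp only [P, Fin.append_right]
        exact ((AffOne.coord _).sub ((hℓ i).comp fun j => AffOne.coord _)).smul s
    let Q : (Fin (din + dout) → ℝ) → (Fin (din + dout) → ℝ) := fun z =>
      Fin.append (fun i => z (Fin.castAdd dout i) - c)
        (fun i => ℓ (fun j => z (Fin.castAdd dout j) - c) i + s * z (Fin.natAdd din i))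
    have hQ : ∀ i, AffOne (fun z => Q z i) := by
      intro i
      refine Fin.addCases (fun i => ?_) (fun i => ?_) i
      · simp only [Q, Fin.append_left]
        exact (AffOne.coord _).sub (AffOne.const c)
      · simp only [Q, Fin.append_right]
        exact ((hℓ i).comp fun j => (AffOne.coord _).sub (AffOne.const c)).add
          ((AffOne.coord _).smul s)
    obtain ⟨f, hf, hfx⟩ := ih _ P hP
    refine ⟨_, Hid.succ f hf (fun z => E (Q z)) ?_, fun x hx => ?_⟩
    · rw [isAffineMap_iff]
      exact fun i => (hE i).comp hQ
    · simp only [hfx x hx]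
      congr 1
      have h1 : ∀ j, relu (P (Fin.append x (g x))) (Fin.castAdd dout j) = x j + c := by
        intro j
        simp [relu, P, hc x hx j]
      have h2 : ∀ j, relu (P (Fin.append x (g x))) (Fin.natAdd din j)
          = max 0 (s * (g x j - ℓ x j)) := by
        intro j
        simp [relu, P]
      simp only [Q, h1, h2, add_sub_cancel_right]
  induction hg with
  | affine ℓ hℓ =>
    refine ⟨0, rfl, fun m E hE => ⟨_, Hid.zero _ ?_, fun x _ => rfl⟩⟩
    rw [isAffineMap_iff] at hℓ hE ⊢
    intro i
    refine (hE i).comp fun j => ?_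
    refine Fin.addCases (fun j => ?_) (fun j => ?_) j
    · simp only [Fin.append_left]
      exact AffOne.coord _
    · simp only [Fin.append_right]
      exact hℓ j
  | @max L g hg ℓ hℓ ih =>
    obtain ⟨k, rfl, ih⟩ := ih
    refine ⟨k + 1, rfl, ?_⟩
    have e : (fun x i => max (ℓ x i) (g x i)) =
        fun x i => ℓ x i + 1 * max 0 (1 * (g x i - ℓ x i)) := by
      funext x i
      rcases le_total (ℓ x i) (g x i) with h | h
      · rw [max_eq_right h, max_eq_right (by linarith)]; ring
      · rw [max_eq_left h, max_eq_left (by linarith)]; ring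
    rw [e]
    exact step 1 k g ℓ hℓ ih
  | @min L g hg ℓ hℓ ih =>
    obtain ⟨k, rfl, ih⟩ := ih
    refine ⟨k + 1, rfl, ?_⟩
    have e : (fun x i => min (ℓ x i) (g x i)) =
        fun x i => ℓ x i + (-1) * max 0 ((-1) * (g x i - ℓ x i)) := by
      funext x i
      rcases le_total (ℓ x i) (g x i) with h | h
      · rw [min_eq_left h, max_eq_left (by linarith)]; ring
      · rw [min_eq_right h, max_eq_right (by linarith)]; ring
    rw [e]
    exact step (-1) k g ℓ hℓ ih

/-- Every max-min string of length `L ≥ 1` on `d_in` input and `d_out` output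
variables coincides, on any compact `K ⊆ ℝ^{d_in}`, with a ReLU network of depth `L` all of
whose hidden widths equal `d_in + d_out`. -/
theorem stmt1 (din dout : ℕ) (Len : ℕ) (hLen : 1 ≤ Len)
    (g : (Fin din → ℝ) → (Fin dout → ℝ)) (hg : IsMaxMinString din dout Len g)
    (K : Set (Fin din → ℝ)) (hK : IsCompact K) :
    ∃ N : ReLUNet din dout, N.depth = Len ∧
      (∀ l : Fin (N.depth + 1), 0 < (l : ℕ) → (l : ℕ) < N.depth → N.dims l = din + dout) ∧
      ∀ x ∈ K, N.eval x = g x := by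
  obtain ⟨C, hC⟩ := hK.isBounded.exists_norm_le
  have hc : ∀ x ∈ K, ∀ i, 0 ≤ x i + C := by
    intro x hx i
    have h1 := (norm_le_pi_norm x i).trans (hC x hx)
    rw [Real.norm_eq_abs] at h1
    linarith [(abs_le.mp h1).1]
  obtain ⟨k, rfl, h⟩ := string_hid hg K C hc
  obtain ⟨f, hf, hfx⟩ := h dout (fun z i => z (Fin.natAdd din i))
    ((isAffineMap_iff _).2 fun i => AffOne.coord _)
  obtain ⟨N, hN, hd, he⟩ := hf.exists_net
  refine ⟨N, hN, hd, fun x hx => ?_⟩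
  rw [he, hfx x hx]
  funext i
  simp

end
end

section
/- For every continuous function f : [0,1]^{d_in} → ℝ^{d_out} and every ε > 0, there exists a ReLU network N with input dimension d_in, output dimension d_out, and width at most d_in + d_out such that sup_{x ∈ [0,1]^{d_in}} ‖f(x) − N(x)‖ ≤ ε. -/
open scoped ENNReal

noncomputable section

/-! ### Auxiliary material for the proof -/

namespace WidthAux

/-- Points of the unit cube. -/
def Cube {n : ℕ} (x : Fin n → ℝ) : Prop := ∀ i, x i ∈ Set.Icc (0 : ℝ) 1

/-- Extension of a vector by zero. -/
def ext0 {n : ℕ} (x : Fin n → ℝ) (j : ℕ) : ℝ := if h : j < n then x ⟨j, h⟩ else 0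

/-- Pre-activation states with weights indexed by natural numbers. -/
def st (din m : ℕ) (W : ℕ → ℕ → ℕ → ℝ) (B : ℕ → ℕ → ℝ) : ℕ → (Fin din → ℝ) → ℕ → ℝ
  | 0, x, i => (∑ j ∈ Finset.range din, W 0 i j * ext0 x j) + B 0 i
  | k + 1, x, i => (∑ j ∈ Finset.range m, W (k + 1) i j * max 0 (st din m W B k x j)) + B (k + 1) i

theorem st_congr (din m : ℕ) (W W' : ℕ → ℕ → ℕ → ℝ) (B B' : ℕ → ℕ → ℝ) (n : ℕ)
    (hW : ∀ k ≤ n, W k = W' k) (hB : ∀ k ≤ n, B k = B' k) :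
    st din m W B n = st din m W' B' n := by
  induction n with
  | zero => funext x i; simp [st, hW 0 le_rfl, hB 0 le_rfl]
  | succ k ih =>
    have h := ih (fun j hj => hW j (by omega)) (fun j hj => hB j (by omega))
    funext x i
    simp [st, h, hW (k+1) le_rfl, hB (k+1) le_rfl]

/-- States reachable by a network of width `m`. -/
def Q (din m : ℕ) (φ : (Fin din → ℝ) → ℕ → ℝ) : Prop :=
  ∃ n W B, ∀ x, Cube x → ∀ i < m, st din m W B n x i = φ x i

/-- `t` is an affine function of the activated state on the cube. -/
def Aff {din : ℕ} (m : ℕ) (φ : (Fin din → ℝ) → ℕ → ℝ) (t : (Fin din → ℝ) → ℝ) : Prop :=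
  ∃ (a : ℕ → ℝ) (c : ℝ), ∀ x, Cube x → t x = (∑ j ∈ Finset.range m, a j * max 0 (φ x j)) + c

section
variable {din m : ℕ} {φ : (Fin din → ℝ) → ℕ → ℝ}

theorem Aff.const (c : ℝ) : Aff m φ (fun _ => c) := ⟨fun _ => 0, c, by simp⟩

theorem Aff.add {s t : (Fin din → ℝ) → ℝ} (hs : Aff m φ s) (ht : Aff m φ t) :
    Aff m φ (fun x => s x + t x) := by
  obtain ⟨a, c, h⟩ := hs
  obtain ⟨b, d, k⟩ := ht
  refine ⟨fun j => a j + b j, c + d, fun x hx => ?_⟩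
  beta_reduce
  rw [h x hx, k x hx]
  simp only [add_mul, Finset.sum_add_distrib]
  ring

theorem Aff.smul {s : (Fin din → ℝ) → ℝ} (r : ℝ) (hs : Aff m φ s) :
    Aff m φ (fun x => r * s x) := by
  obtain ⟨a, c, h⟩ := hs
  refine ⟨fun j => r * a j, r * c, fun x hx => ?_⟩
  beta_reduce
  rw [h x hx, mul_add, Finset.mul_sum]
  simp only [mul_assoc]

theorem Aff.sum {ι : Type*} (S : Finset ι) {s : ι → (Fin din → ℝ) → ℝ}
    (hs : ∀ i, Aff m φ (s i)) : Aff m φ (fun x => ∑ i ∈ S, s i x) := by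
  classical
  induction S using Finset.induction_on with
  | empty => simpa using Aff.const (m := m) (φ := φ) 0
  | insert a S ha ih =>
    simp only [Finset.sum_insert ha]
    exact (hs a).add ih

theorem Aff.coord {j : ℕ} (hj : j < m) : Aff m φ (fun x => max 0 (φ x j)) := by
  refine ⟨fun k => if k = j then 1 else 0, 0, fun x _ => ?_⟩
  simp [hj]

theorem Aff.congr {s t : (Fin din → ℝ) → ℝ} (hs : Aff m φ s) (h : ∀ x, Cube x → t x = s x) :
    Aff m φ t := by
  obtain ⟨a, c, k⟩ := hs
  exact ⟨a, c, fun x hx => by rw [h x hx, k x hx]⟩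

theorem Q.step (hQ : Q din m φ) {ψ : (Fin din → ℝ) → ℕ → ℝ}
    (h : ∀ i, Aff m φ (fun x => ψ x i)) : Q din m ψ := by
  obtain ⟨n, W, B, hn⟩ := hQ
  choose a c hac using h
  beta_reduce at hac
  refine ⟨n + 1, Function.update W (n + 1) a, Function.update B (n + 1) c, fun x hx i hi => ?_⟩
  have hs : st din m (Function.update W (n + 1) a) (Function.update B (n + 1) c) n
      = st din m W B n := by
    apply st_congr
    · intro k hk; rw [Function.update_of_ne (by omega)]
    · intro k hk; rw [Function.update_of_ne (by omega)]
  rw [st, hs, hac i x hx]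
  simp only [Function.update_self]
  congr 1
  apply Finset.sum_congr rfl
  intro j hj
  rw [hn x hx j (Finset.mem_range.mp hj)]

end

/-- Representable maps. -/
def Rep (din dout : ℕ) (g : (Fin din → ℝ) → Fin dout → ℝ) : Prop :=
  ∃ φ, Q din (din + dout) φ ∧ (∀ j, Aff (din + dout) φ (fun x => x j)) ∧
    ∀ i, Aff (din + dout) φ (fun x => g x i)

theorem Rep.zero (din dout : ℕ) : Rep din dout (fun _ _ => 0) := by
  refine ⟨fun x => ext0 x, ⟨0, fun _ i j => if j = i then 1 else 0, fun _ _ => 0, ?_⟩, ?_, ?_⟩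
  · intro x _ i _
    simp only [st, ite_mul, one_mul, zero_mul, Finset.sum_ite_eq', Finset.mem_range, add_zero]
    split_ifs with h
    · rfl
    · simp [ext0, h]
  · intro j
    refine (Aff.coord (j := j.val) (by omega)).congr fun x hx => ?_
    simp [ext0, (hx j).1]
  · intro i; exact Aff.const 0

theorem Rep.neg {din dout : ℕ} {g : (Fin din → ℝ) → Fin dout → ℝ} (hg : Rep din dout g) :
    Rep din dout (fun x i => - g x i) := by
  obtain ⟨φ, h1, h2, h3⟩ := hg
  exact ⟨φ, h1, h2, fun i => ((h3 i).smul (-1)).congr fun x _ => by ring⟩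

theorem Rep.max {din dout : ℕ} {g : (Fin din → ℝ) → Fin dout → ℝ} (hg : Rep din dout g)
    (a : Fin dout → Fin din → ℝ) (c : Fin dout → ℝ) :
    Rep din dout (fun x i => max ((∑ j, a i j * x j) + c i) (g x i)) := by
  obtain ⟨φ, h1, h2, h3⟩ := hg
  have hl : ∀ (ψ : (Fin din → ℝ) → ℕ → ℝ), (∀ j, Aff (din + dout) ψ (fun x => x j)) →
      ∀ i, Aff (din + dout) ψ (fun x => (∑ j, a i j * x j) + c i) := fun ψ hψ i =>
    (Aff.sum Finset.univ fun j => (hψ j).smul (a i j)).add (Aff.const (c i))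
  let ψ : (Fin din → ℝ) → ℕ → ℝ := fun x k => if h : k < din then x ⟨k, h⟩ else
    if h : k - din < dout then g x ⟨k - din, h⟩ - ((∑ j, a ⟨k - din, h⟩ j * x j) + c ⟨k - din, h⟩)
    else 0
  have hx : ∀ j, Aff (din + dout) ψ (fun x => x j) := by
    intro j
    refine (Aff.coord (j := j.val) (by omega)).congr fun x hx => ?_
    simp [ψ, (hx j).1]
  refine ⟨ψ, h1.step ?_, hx, ?_⟩
  · intro k
    by_cases h : k < din
    · refine (h2 ⟨k, h⟩).congr fun x _ => ?_
      simp [ψ, h]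
    · by_cases h' : k - din < dout
      · refine ((h3 ⟨k - din, h'⟩).add ((hl φ h2 ⟨k - din, h'⟩).smul (-1))).congr fun x _ => ?_
        simp only [ψ, h, h', dif_pos, dif_neg, not_false_eq_true]
        ring
      · refine (Aff.const 0).congr fun x _ => ?_
        simp [ψ, h, h']
  · intro i
    refine ((hl ψ hx i).add (Aff.coord (j := din + i.val) (by omega))).congr fun x _ => ?_
    have : ψ x (din + i.val) = g x i - ((∑ j, a i j * x j) + c i) := by
      simp [ψ]
    rw [this]
    beta_reduce
    rcases le_total ((∑ j, a i j * x j) + c i) (g x i) with h | h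
    · rw [max_eq_right h, max_eq_right (by linarith)]; ring
    · rw [max_eq_left h, max_eq_left (by linarith)]; ring

theorem Rep.min {din dout : ℕ} {g : (Fin din → ℝ) → Fin dout → ℝ} (hg : Rep din dout g)
    (a : Fin dout → Fin din → ℝ) (c : Fin dout → ℝ) :
    Rep din dout (fun x i => min ((∑ j, a i j * x j) + c i) (g x i)) := by
  have h := (hg.neg.max (fun i j => - a i j) (fun i => - c i)).neg
  convert h using 3 with x i
  rw [← min_neg_neg]
  simp only [neg_mul, Finset.sum_neg_distrib, neg_neg, neg_add_rev]
  rw [add_comm]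

/-- The layer dimensions. -/
def dm (din dout n k : ℕ) : ℕ :=
  if k = 0 then din else if k = n + 2 then dout else din + dout

/-- The network with prescribed weights. -/
def net (din dout n : ℕ) (W : ℕ → ℕ → ℕ → ℝ) (B : ℕ → ℕ → ℝ) : ReLUNet din dout where
  depth := n + 2
  depth_pos := by omega
  dims := fun l => dm din dout n l.val
  dims_zero := by simp [dm]
  dims_last := by simp [dm]
  weight := fun l i j => W l.val i.val j.val
  bias := fun l i => B l.val i.val

theorem net_preact (din dout n : ℕ) (W : ℕ → ℕ → ℕ → ℝ) (B : ℕ → ℕ → ℝ) (x : Fin din → ℝ)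
    (k : ℕ) (hk : k < n + 2) (i : Fin (dm din dout n (k + 1))) :
    (net din dout n W B).preact k hk x i = st din (din + dout) W B k x i.val := by
  induction k with
  | zero =>
    have h : ∀ j : Fin din, ext0 x j.val = x j := fun j => by simp [ext0]
    rw [st, ← Fin.sum_univ_eq_sum_range (fun j => W 0 i.val j * ext0 x j)]
    simp only [h]
    rfl
  | succ k ih =>
    have hd : dm din dout n (k + 1) = din + dout := by
      simp only [dm]; rw [if_neg (by omega), if_neg (by omega)]
    have h1 : ∑ j ∈ Finset.range (din + dout),
          W (k + 1) i.val j * max 0 (st din (din + dout) W B k x j)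
        = ∑ j : Fin (dm din dout n (k + 1)), W (k + 1) i.val j.val *
          relu ((net din dout n W B).preact k (Nat.lt_of_succ_lt hk) x) j := by
      have h2 : ∀ F : ℕ → ℝ, ∑ j ∈ Finset.range (din + dout), F j
          = ∑ j : Fin (dm din dout n (k + 1)), F j.val := by
        intro F; rw [Fin.sum_univ_eq_sum_range, hd]
      rw [h2]
      refine Finset.sum_congr rfl fun j _ => ?_
      have h := ih (Nat.lt_of_succ_lt hk) j
      rw [← h]; rfl
    rw [st, h1]
    rfl

theorem Rep.exists_net {din dout : ℕ} {g : (Fin din → ℝ) → Fin dout → ℝ} (hg : Rep din dout g) :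
    ∃ N : ReLUNet din dout, N.width ≤ din + dout ∧ ∀ x, Cube x → N.eval x = g x := by
  obtain ⟨φ, ⟨n, W, B, hn⟩, -, h3⟩ := hg
  choose a c hac using h3
  beta_reduce at hac
  let W' : ℕ → ℕ → ℕ → ℝ := Function.update W (n + 1)
    (fun i j => if h : i < dout then a ⟨i, h⟩ j else 0)
  let B' : ℕ → ℕ → ℝ := Function.update B (n + 1)
    (fun i => if h : i < dout then c ⟨i, h⟩ else 0)
  have hs : st din (din + dout) W' B' n = st din (din + dout) W B n := by
    apply st_congr
    · intro k hk; simp only [W']; rw [Function.update_of_ne (by omega)]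
    · intro k hk; simp only [B']; rw [Function.update_of_ne (by omega)]
  refine ⟨net din dout n W' B', ?_, ?_⟩
  · refine Finset.sup_le fun l _ => ?_
    split_ifs with h
    · have h2 : l.val < n + 2 := h.2
      change dm din dout n l.val ≤ _
      simp only [dm]
      rw [if_neg (by omega), if_neg (by omega)]
    · omega
  · intro x hx
    funext i
    have hi : i.val < dm din dout n (n + 1 + 1) := by simp [dm]
    have h : (net din dout n W' B').eval x i = st din (din + dout) W' B' (n + 1) x i.val :=
      net_preact din dout n W' B' x (n + 1) (by omega) ⟨i.val, hi⟩
    rw [h]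
    rw [st, hs, hac i x hx]
    simp only [W', B', Function.update_self, Fin.is_lt, dif_pos, Fin.eta]
    congr 1
    apply Finset.sum_congr rfl
    intro j hj
    rw [hn x hx j (Finset.mem_range.mp hj)]

/-- The cube in Euclidean space. -/
abbrev CubeE (n : ℕ) : Set (EuclideanSpace ℝ (Fin n)) := {x | ∀ i, x i ∈ Set.Icc (0 : ℝ) 1}

theorem isCompact_cube (n : ℕ) : IsCompact (CubeE n) := by
  have h : IsCompact (Set.univ.pi fun _ : Fin n => Set.Icc (0 : ℝ) 1) :=
    isCompact_univ_pi fun _ => isCompact_Icc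
  have h2 := h.image (PiLp.continuous_toLp 2 (fun _ : Fin n => ℝ))
  convert h2 using 1
  ext x
  constructor
  · intro hx
    exact ⟨WithLp.ofLp x, fun i _ => hx i, rfl⟩
  · rintro ⟨y, hy, rfl⟩ i
    exact hy i trivial

/-- The linear functional `2⟪z, x - z⟫` and its expression through norms. -/
theorem q_eq {n : ℕ} (z x : EuclideanSpace ℝ (Fin n)) :
    (∑ j, 2 * z j * x j) - 2 * ‖z‖ ^ 2 = ‖x‖ ^ 2 - ‖z‖ ^ 2 - ‖x - z‖ ^ 2 := by
  have h := norm_sub_sq_real x z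
  have h2 : inner ℝ x z = ∑ j, z j * x j := by
    simp [PiLp.inner_apply]
  rw [h2] at h
  have h3 : (∑ j, 2 * z j * x j) = 2 * ∑ j, z j * x j := by
    rw [Finset.mul_sum]; simp only [mul_assoc]
  rw [h, h3]; ring

theorem approx {din dout : ℕ} (f : EuclideanSpace ℝ (Fin din) → EuclideanSpace ℝ (Fin dout))
    (hf : ContinuousOn f (CubeE din)) (ε : ℝ) (hε : 0 < ε) :
    ∃ g, Rep din dout g ∧ ∀ x ∈ CubeE din, ∀ i, |g (WithLp.ofLp x) i - f x i| ≤ ε := by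
  classical
  have hK := isCompact_cube din
  -- bounds
  obtain ⟨R, hR0, hR⟩ : ∃ R : ℝ, 0 < R ∧ ∀ x ∈ CubeE din, ‖x‖ ≤ R := by
    obtain ⟨R, hR⟩ := hK.isBounded.exists_norm_le
    exact ⟨max R 1, by positivity, fun x hx => (hR x hx).trans (le_max_left _ _)⟩
  obtain ⟨M, hM0, hM⟩ : ∃ M : ℝ, 0 < M ∧ ∀ x ∈ CubeE din, ∀ i, |f x i| ≤ M := by
    obtain ⟨R, hR⟩ := (hK.image_of_continuousOn hf).isBounded.exists_norm_le
    refine ⟨max R 1, by positivity, fun x hx i => ?_⟩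
    have h1 := hR (f x) ⟨x, hx, rfl⟩
    have h2 := PiLp.norm_apply_le (f x) i
    rw [Real.norm_eq_abs] at h2
    exact h2.trans (h1.trans (le_max_left _ _))
  obtain ⟨δ, hδ, hfδ⟩ : ∃ δ > 0, ∀ x ∈ CubeE din, ∀ y ∈ CubeE din, ‖x - y‖ < δ →
      ∀ i, |f x i - f y i| ≤ ε / 2 := by
    have hu := hK.uniformContinuousOn_of_continuous hf
    rw [Metric.uniformContinuousOn_iff] at hu
    obtain ⟨δ, hδ, h⟩ := hu (ε / 2) (by positivity)
    refine ⟨δ, hδ, fun x hx y hy hxy i => ?_⟩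
    have h1 := h x hx y hy (by rwa [dist_eq_norm])
    rw [dist_eq_norm] at h1
    have h2 := PiLp.norm_apply_le (f x - f y) i
    rw [Real.norm_eq_abs] at h2
    exact h2.trans h1.le
  obtain ⟨K, hK0, hKδ⟩ : ∃ K : ℝ, 0 < K ∧ K * δ ^ 2 = 2 * M :=
    ⟨2 * M / δ ^ 2, by positivity, by field_simp⟩
  obtain ⟨ρ, hρ, hρδ, hρR, hρε⟩ : ∃ ρ > 0, ρ < δ ∧ ρ ≤ R ∧ K * (3 * R * ρ) ≤ ε / 2 := by
    refine ⟨min (min (δ / 2) R) (ε / 2 / (K * (3 * R))), by positivity, ?_, ?_, ?_⟩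
    · exact ((min_le_left _ _).trans (min_le_left _ _)).trans_lt (by linarith)
    · exact (min_le_left _ _).trans (min_le_right _ _)
    · have h := min_le_right (min (δ / 2) R) (ε / 2 / (K * (3 * R)))
      rw [le_div_iff₀ (by positivity)] at h
      linarith
  -- main induction
  have main : ∀ S : Finset (EuclideanSpace ℝ (Fin din)), (∀ z ∈ S, z ∈ CubeE din) →
      ∃ g, Rep din dout g ∧ ∀ z ∈ S, ∀ x ∈ CubeE din, ‖x - z‖ ≤ ρ →
        ∀ i, |g (WithLp.ofLp x) i - f x i| ≤ ε := by
    intro S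
    refine Finset.induction_on_max_value (fun z => ‖z‖) S ?_ ?_
    · intro _; exact ⟨_, Rep.zero din dout, by simp⟩
    · intro z S hzS hmax ih
      intro hS
      obtain ⟨g, hg, hgS⟩ := ih fun w hw => hS w (Finset.mem_insert_of_mem hw)
      have hz : z ∈ CubeE din := hS z (Finset.mem_insert_self _ _)
      refine ⟨_, (hg.max (fun i j => K * (2 * z j)) (fun i => f z i - K * (2 * ‖z‖ ^ 2))).min
        (fun i j => - (K * (2 * z j))) (fun i => f z i + K * (2 * ‖z‖ ^ 2)), ?_⟩
      intro w hw x hx hxw i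
      have hq := q_eq z x
      set q := (∑ j, 2 * z j * x j) - 2 * ‖z‖ ^ 2 with hqdef
      have e1 : (∑ j, K * (2 * z j) * x j) + (f z i - K * (2 * ‖z‖ ^ 2)) = f z i + K * q := by
        have : (∑ j, K * (2 * z j) * x j) = K * ∑ j, 2 * z j * x j := by
          rw [Finset.mul_sum]; simp only [mul_assoc]
        rw [this, hqdef]; ring
      have e2 : (∑ j, -(K * (2 * z j)) * x j) + (f z i + K * (2 * ‖z‖ ^ 2)) = f z i - K * q := by
        have : (∑ j, -(K * (2 * z j)) * x j) = - (K * ∑ j, 2 * z j * x j) := by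
          rw [Finset.mul_sum, ← Finset.sum_neg_distrib]; simp only [mul_assoc, neg_mul]
        rw [this, hqdef]; ring
      rw [e1, e2]
      have hwz : ‖w‖ ≤ ‖z‖ := by
        rcases Finset.mem_insert.mp hw with rfl | h
        · exact le_rfl
        · exact hmax w h
      have hzR := hR z hz
      have hxn : ‖x‖ ≤ ‖z‖ + ρ := by
        have : ‖x‖ ≤ ‖x - w‖ + ‖w‖ := by simpa using norm_add_le (x - w) w
        linarith
      have hz0 := norm_nonneg z
      have hqle : q ≤ 3 * R * ρ - ‖x - z‖ ^ 2 := by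
        nlinarith [norm_nonneg x]
      have hKq : K * q ≤ ε / 2 - K * ‖x - z‖ ^ 2 := by
        have := mul_le_mul_of_nonneg_left hqle hK0.le
        linarith
      have hfx := abs_le.mp (hM x hx i)
      have hfz := abs_le.mp (hM z hz i)
      -- the two one-sided bounds, valid everywhere
      have hb : f z i + K * q ≤ f x i + ε ∧ f x i - ε ≤ f z i - K * q := by
        by_cases hd : ‖x - z‖ < δ
        · have h1 := abs_le.mp (hfδ x hx z hz hd i)
          have h2 : 0 ≤ K * ‖x - z‖ ^ 2 := by positivity
          constructor <;> linarith
        · have h2 : K * δ ^ 2 ≤ K * ‖x - z‖ ^ 2 := by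
            have := not_lt.mp hd
            gcongr
          constructor <;> linarith
      obtain ⟨hb1, hb2⟩ := hb
      rcases Finset.mem_insert.mp hw with rfl | h
      · have h1 := abs_le.mp (hfδ x hx w hz (by linarith) i)
        have hqge : - (3 * R * ρ) ≤ q := by
          have hwx : ‖w‖ ≤ ‖x‖ + ‖x - w‖ := by
            have := norm_sub_le x (x - w)
            simpa using this
          have hx0 := norm_nonneg x
          have hy0 := norm_nonneg (x - w)
          have hxR := hR x hx
          rw [hq]
          nlinarith
        have hKq2 : - (ε / 2) ≤ K * q := by
          have := mul_le_mul_of_nonneg_left hqge hK0.le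
          linarith
        rw [abs_le]
        constructor
        · have : f x i - ε ≤ min (f w i - K * q) (max (f w i + K * q) (g x.ofLp i)) :=
            le_min hb2 (le_max_of_le_left (by linarith))
          linarith
        · have := min_le_left (f w i - K * q) (max (f w i + K * q) (g x.ofLp i))
          linarith
      · have h1 := abs_le.mp (hgS w h x hx hxw i)
        rw [abs_le]
        constructor
        · have : f x i - ε ≤ min (f z i - K * q) (max (f z i + K * q) (g x.ofLp i)) :=
            le_min hb2 (le_max_of_le_right (by linarith))
          linarith
        · have : min (f z i - K * q) (max (f z i + K * q) (g x.ofLp i)) ≤ f x i + ε :=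
            (min_le_right _ _).trans (max_le hb1 (by linarith))
          linarith
  obtain ⟨T, hTs, hTf, hT⟩ := hK.finite_cover_balls hρ
  obtain ⟨g, hg, h⟩ := main hTf.toFinset (fun z hz => hTs (hTf.mem_toFinset.mp hz))
  refine ⟨g, hg, fun x hx => ?_⟩
  obtain ⟨z, hz, hxz⟩ := Set.mem_iUnion₂.mp (hT hx)
  rw [Metric.mem_ball, dist_eq_norm] at hxz
  exact h z (hTf.mem_toFinset.mpr hz) x hx hxz.le

end WidthAux

/-- Every continuous `f : [0,1]^{d_in} → ℝ^{d_out}` is uniformly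
`ε`-approximated on the cube by a ReLU network of width at most `d_in + d_out`. -/
theorem stmt5 (din dout : ℕ)
    (f : EuclideanSpace ℝ (Fin din) → EuclideanSpace ℝ (Fin dout))
    (hf : ContinuousOn f {x : EuclideanSpace ℝ (Fin din) | ∀ i, x i ∈ Set.Icc (0 : ℝ) 1})
    (ε : ℝ) (hε : 0 < ε) :
    ∃ N : ReLUNet din dout, N.width ≤ din + dout ∧
      ∀ x ∈ {x : EuclideanSpace ℝ (Fin din) | ∀ i, x i ∈ Set.Icc (0 : ℝ) 1},
        ‖f x - N.evalE x‖ ≤ ε := by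
  obtain ⟨g, hg, h⟩ := WidthAux.approx f hf (ε / (dout + 1)) (by positivity)
  obtain ⟨N, hN, hNg⟩ := hg.exists_net
  refine ⟨N, hN, fun x hx => ?_⟩
  have hx' : N.eval (WithLp.ofLp x) = g (WithLp.ofLp x) := hNg _ hx
  have hb : ∀ i, |(f x - N.evalE x) i| ≤ ε / (dout + 1) := by
    intro i
    have h1 := h x hx i
    rw [← hx', abs_sub_comm] at h1
    exact h1
  have hd : (0 : ℝ) < dout + 1 := by positivity
  have hsq : ‖f x - N.evalE x‖ ^ 2 ≤ ε ^ 2 := by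
    rw [EuclideanSpace.norm_sq_eq]
    calc ∑ i, ‖(f x - N.evalE x) i‖ ^ 2 ≤ ∑ _i : Fin dout, (ε / (dout + 1)) ^ 2 := by
          refine Finset.sum_le_sum fun i _ => ?_
          have h2 := hb i
          rw [Real.norm_eq_abs]
          gcongr
      _ = dout * (ε / (dout + 1)) ^ 2 := by simp
      _ ≤ (dout + 1) ^ 2 * (ε / (dout + 1)) ^ 2 := by
          gcongr
          have : (0 : ℝ) ≤ dout := by positivity
          nlinarith
      _ = ε ^ 2 := by field_simp
  exact (pow_le_pow_iff_left₀ (norm_nonneg _) hε.le two_ne_zero).mp hsq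

end
end

section
/- For every positive integer d_in there exist a continuous function f : [0,1]^{d_in} → ℝ and ε > 0 such that no ReLU network N with input dimension d_in, output dimension 1, and width at most d_in satisfies sup_{x ∈ [0,1]^{d_in}} |f(x) − N(x)| ≤ ε; that is, the minimal width sufficient for uniform universal approximation of continuous scalar functions on [0,1]^{d_in} is at least d_in + 1. -/
open scoped ENNReal

noncomputable section

/-- Every sublevel value attained inside a relatively compact open set is attained on its frontier. -/
def EscProp {X : Type*} [TopologicalSpace X] (g : X → ℝ) : Prop :=
  ∀ U : Set X, IsOpen U → IsCompact (closure U) → ∀ x ∈ U, ∃ y ∈ frontier U, g y ≤ g x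

theorem EscProp.comp_homeo {X Y : Type*} [TopologicalSpace X] [TopologicalSpace Y] {g : Y → ℝ}
    (hg : EscProp g) (T : X ≃ₜ Y) : EscProp (fun x => g (T x)) := by
  intro U hU hc x hx
  obtain ⟨y, hy, hle⟩ := hg (T '' U) (T.isOpenMap U hU)
    (by rw [← T.image_closure]; exact hc.image T.continuous) (T x) ⟨x, hx, rfl⟩
  rw [← T.image_frontier] at hy
  obtain ⟨z, hz, rfl⟩ := hy
  exact ⟨z, hz, hle⟩

theorem ray_hits {m : ℕ} {U : Set (Fin m → ℝ)} (hc : IsCompact (closure U)) {x v : Fin m → ℝ}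
    (hx : x ∈ U) (hv : v ≠ 0) : ∃ t : ℝ, 0 ≤ t ∧ x + t • v ∈ frontier U := by
  have hpre : IsPreconnected ((fun t : ℝ => x + t • v) '' Set.Ici 0) :=
    isPreconnected_Ici.image _ (by fun_prop)
  have h1 : (((fun t : ℝ => x + t • v) '' Set.Ici 0) ∩ U).Nonempty :=
    ⟨x, ⟨0, by simp, by simp⟩, hx⟩
  have h2 : (((fun t : ℝ => x + t • v) '' Set.Ici 0) ∩ Uᶜ).Nonempty := by
    obtain ⟨C, hC⟩ := hc.isBounded.exists_norm_le
    have hvn : 0 < ‖v‖ := norm_pos_iff.mpr hv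
    have hC0 : 0 ≤ C := (norm_nonneg _).trans (hC x (subset_closure hx))
    refine ⟨x + ((C + ‖x‖ + 1) / ‖v‖) • v, ⟨_, by simp only [Set.mem_Ici]; positivity, rfl⟩, ?_⟩
    intro hmem
    have h3 := hC _ (subset_closure hmem)
    have h4 : ‖((C + ‖x‖ + 1) / ‖v‖) • v‖ = C + ‖x‖ + 1 := by
      rw [norm_smul, Real.norm_of_nonneg (by positivity)]
      field_simp
    have h5 := norm_sub_le (x + ((C + ‖x‖ + 1) / ‖v‖) • v) x
    rw [add_sub_cancel_left, h4] at h5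
    linarith
  by_contra hno
  push Not at hno
  have hdich : ∀ z ∈ (fun t : ℝ => x + t • v) '' Set.Ici 0,
      z ∈ interior U ∨ z ∈ (closure U)ᶜ := by
    rintro z ⟨t, ht, rfl⟩
    by_contra hz
    push Not at hz
    exact hno t ht ⟨not_not.mp hz.2, hz.1⟩
  obtain ⟨p, hp, hpU⟩ := h1
  obtain ⟨q, hq, hqU⟩ := h2
  obtain ⟨z, -, hz1, hz2⟩ := hpre (interior U) (closure U)ᶜ isOpen_interior
    isClosed_closure.isOpen_compl hdich
    ⟨p, hp, (hdich p hp).resolve_right fun h => h (subset_closure hpU)⟩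
    ⟨q, hq, (hdich q hq).resolve_left fun h => hqU (interior_subset h)⟩
  exact hz2 (subset_closure (interior_subset hz1))

theorem EscProp.of_dir {m : ℕ} {g : (Fin m → ℝ) → ℝ} {v : Fin m → ℝ} (hv : v ≠ 0)
    (h : ∀ x (t : ℝ), 0 ≤ t → g (x + t • v) ≤ g x) : EscProp g := by
  intro U _ hc x hx
  obtain ⟨t, ht, hy⟩ := ray_hits hc hx hv
  exact ⟨_, hy, h x t ht⟩

theorem EscProp.base {m n : ℕ} (hm : 0 < m) (A : Matrix (Fin n) (Fin m) ℝ) (b : Fin n → ℝ)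
    (i : Fin n) : EscProp (fun z => (A.mulVec z + b) i) := by
  by_cases h : A i = 0
  · refine EscProp.of_dir (v := Pi.single ⟨0, hm⟩ 1) (by simp) ?_
    intro x t _
    simp [Matrix.mulVec, h]
  · refine EscProp.of_dir (v := - A i) (by simpa using h) ?_
    intro x t ht
    have : 0 ≤ A i ⬝ᵥ A i := by
      simp only [dotProduct]; exact Finset.sum_nonneg fun j _ => mul_self_nonneg _
    simp only [Matrix.mulVec, Pi.add_apply, dotProduct_add, dotProduct_smul, dotProduct_neg,
      smul_eq_mul]
    nlinarith

theorem EscProp.comp_relu {n : ℕ} {g : (Fin n → ℝ) → ℝ} (hg : EscProp g) :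
    EscProp (fun z => g (relu z)) := by
  intro U hU hc x hx
  -- points with a nonpositive coordinate escape along that coordinate
  have key : ∀ y ∈ U, (∃ i, y i ≤ 0) → ∃ w ∈ frontier U, g (relu w) ≤ g (relu y) := by
    rintro y hy ⟨i, hi⟩
    obtain ⟨t, ht, hw⟩ := ray_hits hc hy (v := - Pi.single i (1 : ℝ)) (by simp)
    refine ⟨_, hw, le_of_eq ?_⟩
    congr 1
    funext j
    by_cases hj : j = i
    · subst hj
      simp only [relu, Pi.add_apply, Pi.smul_apply, Pi.neg_apply, Pi.single_eq_same, smul_eq_mul]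
      rw [max_eq_left hi, max_eq_left (by linarith)]
    · simp [relu, Pi.single_eq_of_ne hj]
  by_cases hpos : ∃ i, x i ≤ 0
  · exact key x hx hpos
  push Not at hpos
  have hOo : IsOpen {z : Fin n → ℝ | ∀ i, 0 < z i} := by
    rw [Set.ofPred_forall]
    exact isOpen_iInter_of_finite fun i => isOpen_lt continuous_const (continuous_apply i)
  have hOc : IsClosed {z : Fin n → ℝ | ∀ i, 0 ≤ z i} := by
    rw [Set.ofPred_forall]
    exact isClosed_iInter fun i => isClosed_le continuous_const (continuous_apply i)
  have hr : ∀ z : Fin n → ℝ, (∀ i, 0 ≤ z i) → relu z = z := by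
    intro z hz; funext i; exact max_eq_right (hz i)
  obtain ⟨y, hy, hle⟩ := hg (U ∩ {z | ∀ i, 0 < z i}) (hU.inter hOo)
    (hc.of_isClosed_subset isClosed_closure (closure_mono Set.inter_subset_left)) x ⟨hx, hpos⟩
  have hy0 : ∀ i, 0 ≤ y i := by
    have : closure (U ∩ {z : Fin n → ℝ | ∀ i, 0 < z i}) ⊆ {z | ∀ i, 0 ≤ z i} :=
      closure_minimal (fun z hz i => (hz.2 i).le) hOc
    exact this hy.1
  have hle' : g (relu y) ≤ g (relu x) := by
    rw [hr y hy0, hr x fun i => (hpos i).le]; exact hle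
  by_cases hyU : y ∈ U
  · have : ∃ i, y i ≤ 0 := by
      by_contra hcon
      push Not at hcon
      rw [(hU.inter hOo).frontier_eq] at hy
      exact hy.2 ⟨hyU, hcon⟩
    obtain ⟨w, hw, hw2⟩ := key y hyU this
    exact ⟨w, hw, hw2.trans hle'⟩
  · refine ⟨y, ?_, hle'⟩
    rw [hU.frontier_eq]
    exact ⟨closure_mono Set.inter_subset_left hy.1, hyU⟩

theorem EscProp.step {m n : ℕ} (hnm : n ≤ m) (A : Matrix (Fin n) (Fin m) ℝ) (b : Fin n → ℝ)
    {g : (Fin n → ℝ) → ℝ} (hg : m ≤ n → EscProp g) :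
    EscProp (fun z => g (relu (A.mulVec z + b))) := by
  by_cases hinj : Function.Injective A.mulVecLin
  · have hmn : m ≤ n := by
      simpa using LinearMap.finrank_le_finrank_of_injective hinj
    have hfr : Module.finrank ℝ (Fin m → ℝ) = Module.finrank ℝ (Fin n → ℝ) := by
      simp; omega
    let e := (LinearEquiv.ofInjectiveOfFinrankEq A.mulVecLin hinj hfr).toContinuousLinearEquiv
    have := ((hg hmn).comp_relu).comp_homeo (e.toHomeomorph.trans (Homeomorph.addRight b))
    exact this
  · rw [← LinearMap.ker_eq_bot, Submodule.eq_bot_iff] at hinj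
    push Not at hinj
    obtain ⟨v, hv, hv0⟩ := hinj
    refine EscProp.of_dir hv0 ?_
    intro x t _
    have hv' : A.mulVec v = 0 := by simpa using hv
    simp [Matrix.mulVec_add, Matrix.mulVec_smul, hv']

theorem ReLUNet.esc_tail {din : ℕ} (hdin : 0 < din) (N : ReLUNet din 1) (hw : N.width ≤ din)
    (j : ℕ) : ∀ (k : ℕ) (hk : k < N.depth), k + j + 1 = N.depth →
    ∃ h : (Fin (N.dims ⟨k + 1, Nat.succ_lt_succ hk⟩) → ℝ) → ℝ,
      (∀ x, N.eval x 0 = h (N.preact k hk x)) ∧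
      (din ≤ N.dims (Fin.castSucc ⟨k, hk⟩) →
        EscProp (fun z => h ((N.weight ⟨k, hk⟩).mulVec z + N.bias ⟨k, hk⟩))) := by
  induction j with
  | zero =>
    intro k hk hj
    obtain rfl : k = N.depth - 1 := by omega
    refine ⟨fun z => z (Fin.cast N.last_dim.symm 0), fun x => rfl, fun hd => ?_⟩
    exact EscProp.base (hdin.trans_le hd) _ _ _
  | succ j ih =>
    intro k hk hj
    have hk1 : k + 1 < N.depth := by omega
    obtain ⟨h, hh, hesc⟩ := ih (k + 1) hk1 (by omega)
    have hwk : N.dims ⟨k + 1, Nat.succ_lt_succ hk⟩ ≤ din := by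
      have := Finset.le_sup (f := fun l : Fin (N.depth + 1) =>
        if 0 < (l : ℕ) ∧ (l : ℕ) < N.depth then N.dims l else 0)
        (Finset.mem_univ ⟨k + 1, Nat.succ_lt_succ hk⟩)
      simp only [Nat.succ_pos, hk1, and_self, if_true] at this
      exact this.trans hw
    refine ⟨fun z => h ((N.weight ⟨k + 1, hk1⟩).mulVec (relu z) + N.bias ⟨k + 1, hk1⟩),
      fun x => hh x, fun hd => ?_⟩
    exact EscProp.step (hwk.trans hd) _ _
      (g := fun z => h ((N.weight ⟨k + 1, hk1⟩).mulVec z + N.bias ⟨k + 1, hk1⟩))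
      (fun hle => hesc (hd.trans hle))

theorem ReLUNet.esc {din : ℕ} (hdin : 0 < din) (N : ReLUNet din 1) (hw : N.width ≤ din) :
    EscProp (fun x => N.eval x 0) := by
  obtain ⟨h, hh, hesc⟩ := N.esc_tail hdin hw (N.depth - 1) 0 N.depth_pos
    (by have := N.depth_pos; omega)
  have h0 := N.dims_zero
  have h1 := hesc (le_of_eq h0.symm)
  have h2 := h1.comp_homeo
    (Homeomorph.piCongrLeft (Y := fun _ => ℝ) (finCongr h0)).symm
  have h3 : (fun x => N.eval x 0) = _ := funext hh
  rw [h3]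
  exact h2

/-- For every positive `d_in` there are a continuous
`f : [0,1]^{d_in} → ℝ` and an `ε > 0` such that no ReLU network with input dimension `d_in`,
output dimension `1` and width at most `d_in` uniformly `ε`-approximates `f` on the cube:
the minimal width for universal approximation is at least `d_in + 1`. -/
theorem stmt6 (din : ℕ) (hdin : 0 < din) :
    ∃ f : EuclideanSpace ℝ (Fin din) → ℝ,
      ContinuousOn f {x : EuclideanSpace ℝ (Fin din) | ∀ i, x i ∈ Set.Icc (0 : ℝ) 1} ∧
      ∃ ε : ℝ, 0 < ε ∧
        ∀ N : ReLUNet din 1, N.width ≤ din →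
          ∃ x ∈ {x : EuclideanSpace ℝ (Fin din) | ∀ i, x i ∈ Set.Icc (0 : ℝ) 1},
            ε < |f x - N.evalE x 0| := by
  refine ⟨fun x => ‖(fun i => x i - 1 / 2 : Fin din → ℝ)‖, by fun_prop, 1 / 8, by norm_num, ?_⟩
  intro N hw
  by_contra hcon
  push Not at hcon
  set c : Fin din → ℝ := fun _ => 1 / 2 with hcdef
  have happ : ∀ y : Fin din → ℝ, ‖y - c‖ ≤ 1 / 2 → |‖y - c‖ - N.eval y 0| ≤ 1 / 8 := by
    intro y hy
    refine hcon (WithLp.toLp 2 y) ?_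
    intro i
    have := (norm_le_pi_norm (y - c) i).trans hy
    rw [Real.norm_eq_abs, abs_le] at this
    simp only [Pi.sub_apply, hcdef] at this
    constructor <;> simp only <;> linarith [this.1, this.2]
  have : Nonempty (Fin din) := ⟨⟨0, hdin⟩⟩
  obtain ⟨y, hy, hle⟩ := N.esc hdin hw (Metric.ball c (1 / 2)) Metric.isOpen_ball
    ((isCompact_closedBall c (1 / 2)).of_isClosed_subset isClosed_closure
      Metric.closure_ball_subset_closedBall) c (Metric.mem_ball_self (by norm_num))
  have hyn : ‖y - c‖ = 1 / 2 := by
    have := Metric.frontier_ball_subset_sphere hy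
    rwa [mem_sphere_iff_norm] at this
  have h1 := happ y hyn.le
  have h2 := happ c (by simp)
  rw [hyn, abs_le] at h1
  rw [sub_self, norm_zero, abs_le] at h2
  simp only at hle
  linarith [h1.1, h1.2, h2.1, h2.2]

end
end

section
/- Let d be a positive integer. For every Lebesgue integrable function f : ℝ^d → ℝ and every ε > 0, there exists a ReLU residual network R with one neuron per hidden layer such that ‖f − R‖_{L¹(ℝ^d)} ≤ ε; here R is a function of the form R = w ∘ T_N ∘ ⋯ ∘ T_1, where each residual block T_j : ℝ^d → ℝ^d has the form T_j(x) = x + v_j · max(0, u_jᵀ x + b_j) with u_j, v_j ∈ ℝ^d and b_j ∈ ℝ, and w : ℝ^d → ℝ is an affine map. -/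
open scoped ENNReal

noncomputable section

/-- One-dimensional residual compositions. -/
inductive Q1 : (ℝ → ℝ) → Prop
  | id : Q1 (fun t => t)
  | step {h : ℝ → ℝ} (hh : Q1 h) (u c b : ℝ) : Q1 (fun t => h t + c * max 0 (u * h t + b))

theorem Q1.comp {g h : ℝ → ℝ} (hg : Q1 g) (hh : Q1 h) : Q1 (fun t => g (h t)) := by
  induction hg with
  | id => exact hh
  | step _ u c b ih => exact Q1.step ih u c b

theorem Q1.continuous {g : ℝ → ℝ} (hg : Q1 g) : Continuous g := by
  induction hg with
  | id => exact continuous_id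
  | step _ u c b ih => fun_prop

theorem Q1.upper (b s : ℝ) : ∃ T, Q1 T ∧ (∀ t ≤ b, T t = t) ∧ ∀ t, b ≤ t → T t = b + s * (t - b) := by
  refine ⟨_, Q1.step Q1.id 1 (s - 1) (-b), ?_, ?_⟩
  · intro t ht
    try simp only
    rw [max_eq_left (by linarith)]; ring
  · intro t ht
    try simp only
    rw [max_eq_right (by linarith)]; ring

theorem Q1.lower (b s : ℝ) : ∃ T, Q1 T ∧ (∀ t, b ≤ t → T t = t) ∧ ∀ t ≤ b, T t = b + s * (t - b) := by
  refine ⟨_, Q1.step Q1.id (-1) (1 - s) b, ?_, ?_⟩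
  · intro t ht
    try simp only
    rw [max_eq_left (by linarith)]; ring
  · intro t ht
    try simp only
    rw [max_eq_right (by linarith)]; ring

theorem Q1.conj {q : ℝ → ℝ} (hq : Q1 q) (m c : ℝ) (hm : m ≠ 0) :
    ∃ q', Q1 q' ∧ ∀ t, q (m * t + c) = m * q' t + c := by
  induction hq with
  | id => exact ⟨_, Q1.id, fun t => rfl⟩
  | step _ u e b ih =>
    obtain ⟨q', h1, h2⟩ := ih
    refine ⟨_, Q1.step h1 (u * m) (e / m) (u * c + b), ?_⟩
    intro t
    simp only [h2]
    have : u * (m * q' t + c) + b = u * m * q' t + (u * c + b) := by ring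
    rw [this]
    field_simp
    ring

theorem Q1.bump (k η : ℝ) (h0 : 0 < η) (h1 : η < 1) : ∃ T, Q1 T ∧ (∀ t ≤ k, T t = t) ∧
    (∀ t, k + 1 ≤ t → T t = t) ∧ (∀ t, k ≤ t → t ≤ k + 1 → k ≤ T t ∧ T t ≤ k + 1) ∧
    (∀ t, k ≤ t → t ≤ k + 1 - η → T t = k + η * (t - k)) := by
  obtain ⟨A, hA, A1, A2⟩ := Q1.upper k η
  obtain ⟨s, hs⟩ : ∃ s, s = (1 - η * (1 - η)) / (η * η) := ⟨_, rfl⟩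
  have hs' : s * (η * η) = 1 - η * (1 - η) := by rw [hs]; field_simp
  have hspos : 0 < s := by
    rw [hs]; apply div_pos <;> nlinarith
  obtain ⟨B, hB, B1, B2⟩ := Q1.upper (k + η * (1 - η)) s
  obtain ⟨C, hC, C1, C2⟩ := Q1.upper (k + 1) (1 / (η * s))
  have hη : η * (1 - η) < 1 := by nlinarith
  have hη0 : 0 < η * (1 - η) := by nlinarith
  have key : ∀ t, k + 1 - η ≤ t → B (A t) = k + η * (1 - η) + s * (η * (t - (k + 1 - η))) := by
    intro t ht
    rw [A2 t (by linarith), B2 _ (by nlinarith)]; ring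
  have key2 : ∀ t, k ≤ t → t ≤ k + 1 - η → B (A t) = k + η * (t - k) := by
    intro t ht ht'
    rw [A2 t (by linarith), B1 _ (by nlinarith)]
  have hsη : 0 < s * η := by positivity
  have low : ∀ t, k ≤ t → t ≤ k + 1 - η → C (B (A t)) = k + η * (t - k) := by
    intro t ht ht'
    rw [key2 t ht ht', C1]
    nlinarith
  refine ⟨_, hC.comp (hB.comp hA), ?_, ?_, ?_, low⟩
  · intro t ht
    try simp only
    rw [A1 t ht, B1 t (by linarith), C1 t (by linarith)]
  · intro t ht
    try simp only
    rw [key t (by linarith), C2 _ (by nlinarith)]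
    have : k + η * (1 - η) + s * (η * (t - (k + 1 - η))) - (k + 1) = η * s * (t - (k + 1)) := by
      linear_combination hs'
    rw [this]; field_simp; ring
  · intro t ht ht'
    rcases le_total t (k + 1 - η) with h | h
    · try simp only
      rw [low t ht h]
      constructor <;> nlinarith
    · try simp only
      rw [key t h, C1 _ (by nlinarith)]
      constructor <;> nlinarith [mul_nonneg hsη.le (sub_nonneg.2 h)]

theorem Q1.stair (N : ℕ) (η : ℝ) (h0 : 0 < η) (h1 : η < 1) : ∃ T, Q1 T ∧ (∀ t ≤ 0, T t = t) ∧
    (∀ t, (N : ℝ) ≤ t → T t = t) ∧ (∀ t : ℝ, 0 ≤ t → t ≤ N → 0 ≤ T t ∧ T t ≤ N) ∧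
    (∀ k : ℕ, k < N → ∀ t, (k : ℝ) ≤ t → t ≤ k + 1 - η → T t = k + η * (t - k)) := by
  induction N with
  | zero =>
    refine ⟨_, Q1.id, fun t _ => rfl, fun t _ => rfl, fun t a b => ⟨a, b⟩, fun k hk => ?_⟩
    omega
  | succ N ih =>
    obtain ⟨T, hT, T1, T2, T3, T4⟩ := ih
    obtain ⟨B, hB, B1, B2, B3, B4⟩ := Q1.bump N η h0 h1
    have hN : (0 : ℝ) ≤ N := Nat.cast_nonneg N
    refine ⟨_, hB.comp hT, ?_, ?_, ?_, ?_⟩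
    · intro t ht
      try simp only
      rw [T1 t ht, B1 t (by linarith)]
    · intro t ht
      push_cast at ht
      try simp only
      rw [T2 t (by linarith), B2 t (by linarith)]
    · intro t ht ht'
      push_cast at ht' ⊢
      rcases le_total t N with h | h
      · have := T3 t ht h
        rw [B1 _ this.2]
        exact ⟨this.1, by linarith⟩
      · rw [T2 t h]
        have := B3 t h ht'
        exact ⟨by linarith, by linarith⟩
    · intro k hk t ht ht'
      try simp only
      rcases Nat.lt_succ_iff_lt_or_eq.1 hk with h | h
      · have e : (k : ℝ) + 1 ≤ N := by exact_mod_cast h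
        have hk0 : (0 : ℝ) ≤ k := Nat.cast_nonneg k
        have := T3 t (by linarith) (by linarith)
        rw [B1 _ this.2, T4 k h t ht ht']
      · subst h
        rw [T2 t ht, B4 t ht ht']

open Filter Topology in
theorem Q1.digits (N : ℕ) (L : ℝ) (hL : (N : ℝ) ≤ L) : ∃ q : ℕ → ℝ → ℝ, (∀ n, Q1 (q n)) ∧
    (∀ n t, 0 ≤ q n t) ∧
    (∀ (n : ℕ) (t : ℝ), (t ≤ -(1 / ((n : ℝ) + 1)) ∨ (N : ℝ) + 1 / ((n : ℝ) + 1) ≤ t) → L ≤ q n t) ∧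
    (∀ t : ℝ, 0 ≤ t → t ≤ N → Tendsto (fun n => q n t) atTop (𝓝 ((⌊t⌋₊ : ℕ) : ℝ))) := by
  have hN : (0 : ℝ) ≤ N := Nat.cast_nonneg N
  have hη0 : ∀ n : ℕ, 0 < 1 / ((n : ℝ) + 2) := fun n => by positivity
  have hη1 : ∀ n : ℕ, 1 / ((n : ℝ) + 2) < 1 := fun n => by
    rw [div_lt_one (by positivity)]; linarith [(Nat.cast_nonneg n : (0 : ℝ) ≤ n)]
  choose S hS S1 S2 S3 S4 using fun n : ℕ => Q1.stair N (1 / ((n : ℝ) + 2)) (hη0 n) (hη1 n)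
  choose A hA A1 A2 using fun n : ℕ => Q1.lower 0 (-(((n : ℝ) + 1) * (L + 1)))
  choose U hU U1 U2 using fun n : ℕ => Q1.upper N (((n : ℝ) + 1) * (L + 1))
  have hK : ∀ n : ℕ, 1 ≤ ((n : ℝ) + 1) * (L + 1) := fun n => by
    have : (0 : ℝ) ≤ n := Nat.cast_nonneg n
    nlinarith
  have hAn : ∀ n t, 0 ≤ A n t := by
    intro n t
    rcases le_total 0 t with h | h
    · rw [A1 n t h]; exact h
    · rw [A2 n t h]; nlinarith [hK n]
  have big : ∀ n x, (N : ℝ) ≤ x → x ≤ U n (S n x) := by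
    intro n x hx
    rw [S2 n x hx, U2 n x hx]; nlinarith [hK n]
  refine ⟨fun n t => U n (S n (A n t)), fun n => (hU n).comp ((hS n).comp (hA n)), ?_, ?_, ?_⟩
  · intro n t
    rcases le_total (A n t) N with h | h
    · have := S3 n _ (hAn n t) h
      try simp only
      rw [U1 n _ this.2]; exact this.1
    · exact (hAn n t).trans (big n _ h)
  · intro n t ht
    have hn : (0 : ℝ) < (n : ℝ) + 1 := by positivity
    have hi : ((n : ℝ) + 1) * (1 / ((n : ℝ) + 1)) = 1 := by field_simp
    have hp : 0 < 1 / ((n : ℝ) + 1) := by positivity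
    set r := 1 / ((n : ℝ) + 1)
    rcases ht with h | h
    · have : L ≤ A n t := by
        rw [A2 n t (by linarith)]
        have : r * (((n : ℝ) + 1) * (L + 1)) ≤ (-t) * (((n : ℝ) + 1) * (L + 1)) :=
          mul_le_mul_of_nonneg_right (by linarith) (by linarith [hK n])
        have e : r * (((n : ℝ) + 1) * (L + 1)) = L + 1 := by linear_combination (L + 1) * hi
        linarith
      exact this.trans (big n _ (hL.trans this))
    · try simp only
      rw [A1 n t (by linarith), S2 n t (by linarith), U2 n t (by linarith)]
      have : r * (((n : ℝ) + 1) * (L + 1)) ≤ (t - N) * (((n : ℝ) + 1) * (L + 1)) :=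
          mul_le_mul_of_nonneg_right (by linarith) (by linarith [hK n])
      have e : r * (((n : ℝ) + 1) * (L + 1)) = L + 1 := by linear_combination (L + 1) * hi
      linarith
  · intro t h0 h1
    have e : ∀ n, U n (S n (A n t)) = S n t := by
      intro n
      rw [A1 n t h0, U1 n _ (S3 n t h0 h1).2]
    simp only [e]
    have hf1 := Nat.floor_le h0
    have hf2 := Nat.lt_floor_add_one t
    rcases h1.lt_or_eq with h | h
    · have hlt : ⌊t⌋₊ < N := (Nat.floor_lt h0).2 h
      have l0 : Tendsto (fun n : ℕ => 1 / ((n : ℝ) + 2)) atTop (𝓝 0) := by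
        have := (tendsto_const_div_atTop_nhds_zero_nat (1 : ℝ)).comp (tendsto_add_atTop_nat 2)
        refine this.congr fun n => ?_
        simp
      have ev : ∀ᶠ n : ℕ in atTop, 1 / ((n : ℝ) + 2) < ⌊t⌋₊ + 1 - t :=
        l0.eventually_lt_const (by linarith)
      have l1 : Tendsto (fun n : ℕ => (⌊t⌋₊ : ℝ) + 1 / ((n : ℝ) + 2) * (t - ⌊t⌋₊)) atTop
          (𝓝 ⌊t⌋₊) := by
        simpa using (l0.mul_const (t - ⌊t⌋₊)).const_add (⌊t⌋₊ : ℝ)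
      refine l1.congr' ?_
      filter_upwards [ev] with n hn
      rw [S4 n _ hlt t hf1 (by linarith)]
    · subst h
      have : ∀ n, S n (N : ℝ) = N := fun n => S2 n _ le_rfl
      simp [this]

theorem Q1.interp (C : ℝ) (c : ℕ → ℝ) (hc : ∀ k, c k ≤ C) (n : ℕ) :
    ∃ T, Q1 T ∧ (∀ s ≤ C, T s = s) ∧ ∀ k < n, T (C + k + 1) = c k := by
  induction n with
  | zero => exact ⟨_, Q1.id, fun _ _ => rfl, fun k hk => absurd hk (by omega)⟩
  | succ n ih =>
    obtain ⟨T, hT, T1, T2⟩ := ih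
    obtain ⟨U, hU, U1, U2⟩ := Q1.upper (C + n) (c n - (C + n))
    have hn : (0 : ℝ) ≤ n := Nat.cast_nonneg n
    refine ⟨_, hT.comp hU, ?_, ?_⟩
    · intro s hs
      try simp only
      rw [U1 s (by linarith), T1 s hs]
    · intro k hk
      try simp only
      rcases Nat.lt_succ_iff_lt_or_eq.1 hk with h | h
      · have : (k : ℝ) + 1 ≤ n := by exact_mod_cast h
        rw [U1 _ (by linarith), T2 k h]
      · subst h
        rw [U2 _ (by linarith)]
        have : C + (k : ℝ) + (c k - (C + k)) * (C + k + 1 - (C + k)) = c k := by ring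
        rw [this, T1 _ (hc k)]

theorem Q1.readout (L : ℕ) (c : ℕ → ℝ) (C : ℝ) (hc : ∀ k, c k ≤ C) :
    ∃ T, Q1 T ∧ (∀ k : ℕ, k < L → T (k + (C + 1)) = c k) ∧
      (∀ s, (L : ℝ) ≤ s → T (s + (C + 1)) = c L) ∧ ∃ B, ∀ s, 0 ≤ s → |T (s + (C + 1))| ≤ B := by
  obtain ⟨T, hT, T1, T2⟩ := Q1.interp C c hc (L + 1)
  obtain ⟨U, hU, U1, U2⟩ := Q1.upper (C + L + 1) 0
  have top : ∀ s, (L : ℝ) ≤ s → T (U (s + (C + 1))) = c L := by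
    intro s hs
    rw [U2 _ (by linarith), zero_mul, add_zero, T2 L (by omega)]
  refine ⟨_, hT.comp hU, ?_, top, ?_⟩
  · intro k hk
    have : (k : ℝ) ≤ L := by exact_mod_cast hk.le
    try simp only
    rw [U1 _ (by linarith), ← T2 k (by omega)]
    ring_nf
  · have hcont : Continuous fun s => T (U (s + (C + 1))) :=
      (hT.comp hU).continuous.comp (continuous_add_const (C + 1))
    obtain ⟨B, hB⟩ := (isCompact_Icc (a := (0 : ℝ)) (b := L)).exists_bound_of_continuousOn
      hcont.continuousOn
    refine ⟨B, fun s hs => ?_⟩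
    rcases le_total s L with h | h
    · exact hB s ⟨hs, h⟩
    · have := hB L ⟨Nat.cast_nonneg L, le_rfl⟩
      try simp only at this ⊢
      rw [top _ le_rfl] at this
      rw [top s h]; exact this

theorem IsResNetCore.continuous {d : ℕ} {g : (Fin d → ℝ) → (Fin d → ℝ)} (hg : IsResNetCore d g) :
    Continuous g := by
  induction hg with
  | id => exact continuous_id
  | step _ u v b ih => fun_prop

theorem core_update {d : ℕ} {q : ℝ → ℝ} (hq : Q1 q) (i : Fin d) :
    ∀ {g : (Fin d → ℝ) → (Fin d → ℝ)}, IsResNetCore d g →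
      IsResNetCore d (fun x => Function.update (g x) i (q (g x i))) := by
  induction hq with
  | id => intro g hg; simpa using hg
  | step _ u c b ih =>
    intro g hg
    have := IsResNetCore.step (ih hg) (Pi.single i u) (Pi.single i c) b
    convert this using 2 with x
    funext j
    by_cases hj : j = i
    · subst hj
      simp [Pi.single_apply]
    · simp [hj]

theorem core_all {d : ℕ} {q : ℝ → ℝ} (hq : Q1 q) (s : Finset (Fin d)) :
    IsResNetCore d (fun x i => if i ∈ s then q (x i) else x i) := by
  induction s using Finset.induction_on with
  | empty => simpa using IsResNetCore.id
  | insert a s ha ih =>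
    have := core_update hq a ih
    convert this using 2 with x
    funext j
    by_cases hj : j = a
    · subst hj
      simp [ha]
    · simp [hj]

theorem core_read {d : ℕ} {q : ℝ → ℝ} (hq : Q1 q) {g : (Fin d → ℝ) → (Fin d → ℝ)}
    (hg : IsResNetCore d g) (a : Fin d → ℝ) (i : Fin d) (hi : a i ≠ 0) (e : ℝ) :
    ∃ g', IsResNetCore d g' ∧ ∀ x, (∑ j, a j * g' x j) + e = q ((∑ j, a j * g x j) + e) := by
  induction hq with
  | id => exact ⟨g, hg, fun _ => rfl⟩
  | step _ u c b ih =>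
    obtain ⟨g', h1, h2⟩ := ih
    refine ⟨_, IsResNetCore.step h1 (fun j => u * a j) (Pi.single i (c / a i)) (u * e + b), ?_⟩
    intro x
    simp only [← h2]
    have e1 : (∑ j, u * a j * g' x j) + (u * e + b) = u * ((∑ j, a j * g' x j) + e) + b := by
      rw [mul_add, Finset.mul_sum]
      simp only [mul_assoc]; ring
    simp only [Pi.add_apply, mul_add, Finset.sum_add_distrib, e1]
    have e2 : ∀ M : ℝ, ∑ j, a j * ((Pi.single i (c / a i) : Fin d → ℝ) j * M) = c * M := by
      intro M
      rw [Finset.sum_eq_single i]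
      · simp; field_simp
      · intro j _ hj; simp [hj]
      · simp
    rw [e2]; ring

/-- Readout of a weighted sum of scaled one-dimensional networks. -/
theorem net_of_parts {d : ℕ} {q p : ℝ → ℝ} (hq : Q1 q) (hp : Q1 p) (a : Fin d → ℝ) (i : Fin d)
    (hi : a i ≠ 0) (m c e : ℝ) (hm : m ≠ 0) :
    IsResNet1 d (fun x => p ((∑ j, a j * q (m * x j + c)) + e)) := by
  obtain ⟨q', h1, h2⟩ := hq.conj m c hm
  have hg := core_all (d := d) h1 Finset.univ
  obtain ⟨g', h3, h4⟩ := core_read hp hg (fun j => a j * m) i (mul_ne_zero hi hm)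
    ((∑ j, a j * c) + e)
  refine ⟨g', h3, fun j => a j * m, (∑ j, a j * c) + e, fun x => ?_⟩
  rw [h4]
  simp only [h2, mul_add, Finset.sum_add_distrib, Finset.mem_univ, if_true, mul_assoc, add_assoc]

open MeasureTheory Filter Topology in
theorem l1_small {d : ℕ} (F : ℕ → (Fin d → ℝ) → ℝ) (G : (Fin d → ℝ) → ℝ)
    (hF : ∀ n, Measurable (F n)) (B r : ℝ) (hB : ∀ n x, |F n x| ≤ B)
    (h0 : ∀ n x, r < ‖x‖ → F n x = 0)
    (hlim : ∀ x, Tendsto (fun n => F n x) atTop (𝓝 (G x))) (ε : ℝ) (hε : 0 < ε) :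
    ∃ n, eLpNorm (fun x => G x - F n x) 1 volume ≤ ENNReal.ofReal ε := by
  have hint : Integrable ((Metric.closedBall (0 : Fin d → ℝ) r).indicator fun _ => B) volume := by
    rw [integrable_indicator_iff measurableSet_closedBall]
    exact integrableOn_const (by exact measure_closedBall_lt_top.ne)
  have := tendsto_lintegral_norm_of_dominated_convergence (μ := volume) (F := F) (f := G)
    (fun n => (hF n).aestronglyMeasurable) hint.hasFiniteIntegral (fun n => ae_of_all _ fun x => ?_)
    (ae_of_all _ hlim)
  · have ev := this.eventually_lt_const (u := ENNReal.ofReal ε) (by simpa using hε)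
    obtain ⟨n, hn⟩ := ev.exists
    refine ⟨n, ?_⟩
    rw [eLpNorm_one_eq_lintegral_enorm]
    refine le_trans (le_of_eq ?_) hn.le
    refine lintegral_congr fun x => ?_
    rw [← ofReal_norm, norm_sub_rev]
  · by_cases hx : x ∈ Metric.closedBall (0 : Fin d → ℝ) r
    · rw [Set.indicator_of_mem hx]; exact hB n x
    · rw [Set.indicator_of_notMem hx, h0 n x (by simpa using hx)]; simp

/-- Grid sampling of `g` on the box `[-M, M]^d` with mesh `1/m`. -/
def gridF {d : ℕ} (g : (Fin d → ℝ) → ℝ) (M m : ℕ) (x : Fin d → ℝ) : ℝ :=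
  open Classical in
  if ∀ i, 0 ≤ (m : ℝ) * x i + m * M ∧ (m : ℝ) * x i + m * M ≤ ((2 * M * m : ℕ) : ℝ) then
    g (fun i => ((⌊(m : ℝ) * x i + m * M⌋₊ : ℕ) : ℝ) / m - M) else 0

theorem exists_coord {d : ℕ} (x : Fin d → ℝ) (r : ℝ) (hr : 0 ≤ r) (h : r < ‖x‖) :
    ∃ i, x i < -r ∨ r < x i := by
  by_contra hcon
  push Not at hcon
  have := (pi_norm_le_iff_of_nonneg hr).2 (fun i => by
    rw [Real.norm_eq_abs, abs_le]; exact hcon i)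
  linarith

open MeasureTheory Filter Topology in
theorem grid_approx {d : ℕ} (hd : 0 < d) (g : (Fin d → ℝ) → ℝ) (b : ℝ) (hb : ∀ x, |g x| ≤ b)
    (M m : ℕ) (hm : 0 < m) (ε : ℝ) (hε : 0 < ε) :
    ∃ R, IsResNet1 d R ∧ Continuous R ∧
      eLpNorm (fun x => gridF g M m x - R x) 1 volume ≤ ENNReal.ofReal ε := by
  classical
  obtain ⟨N, hN⟩ : ∃ N, N = 2 * M * m := ⟨_, rfl⟩
  have hNR : (N : ℝ) = 2 * M * m := by rw [hN]; push_cast; ring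
  obtain ⟨L, hL⟩ : ∃ L, L = (N + 1) ^ d := ⟨_, rfl⟩
  have hNL : N ≤ L := by
    rw [hL]
    exact (Nat.le_succ N).trans (Nat.le_self_pow hd.ne' _)
  have hNLR : (N : ℝ) ≤ L := by exact_mod_cast hNL
  have hmR : (1 : ℝ) ≤ m := by exact_mod_cast hm
  have hb0 : 0 ≤ b := (abs_nonneg _).trans (hb 0)
  obtain ⟨c, hc⟩ : ∃ c : ℕ → ℝ, c = fun k => if h : k < (N + 1) ^ d then
    g (fun i => ((finFunctionFinEquiv.symm ⟨k, h⟩ i : ℕ) : ℝ) / m - M) else 0 := ⟨_, rfl⟩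
  have hcb : ∀ k, c k ≤ b := by
    intro k
    rw [hc]
    dsimp only
    split_ifs
    · exact (le_abs_self _).trans (hb _)
    · exact hb0
  have hcL : c L = 0 := by rw [hc]; simp [hL]
  obtain ⟨p, hp, p1, p2, B, p3⟩ := Q1.readout L c b hcb
  obtain ⟨q, hq, q1, q2, q3⟩ := Q1.digits N L hNLR
  obtain ⟨a, ha⟩ : ∃ a : Fin d → ℝ, a = fun j : Fin d => ((N : ℝ) + 1) ^ (j : ℕ) := ⟨_, rfl⟩
  have ha1 : ∀ j, 1 ≤ a j := by
    intro j
    rw [ha]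
    exact one_le_pow₀ (by linarith [(Nat.cast_nonneg N : (0 : ℝ) ≤ N)])
  obtain ⟨R, hR⟩ : ∃ R : ℕ → (Fin d → ℝ) → ℝ,
    R = fun n x => p ((∑ j, a j * q n (m * x j + m * M)) + (b + 1)) := ⟨_, rfl⟩
  have hRnet : ∀ n, IsResNet1 d (R n) := by
    intro n
    rw [hR]
    exact net_of_parts (hq n) hp a ⟨0, hd⟩ (by linarith [ha1 ⟨0, hd⟩]) m _ _ (by linarith)
  have hRc : ∀ n, Continuous (R n) := by
    intro n
    have h1 := (hq n).continuous
    have h2 := hp.continuous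
    rw [hR]
    fun_prop
  have hterm : ∀ n (x : Fin d → ℝ) j, 0 ≤ a j * q n (m * x j + m * M) := fun n x j =>
    mul_nonneg (by linarith [ha1 j]) (q1 _ _)
  have hout : ∀ (n : ℕ) (x : Fin d → ℝ) j, ((m : ℝ) * x j + m * M ≤ -(1 / ((n : ℝ) + 1)) ∨
      (N : ℝ) + 1 / ((n : ℝ) + 1) ≤ (m : ℝ) * x j + m * M) → R n x = 0 := by
    intro n x j h
    have h1 := q2 n _ h
    have h2 := Finset.single_le_sum (f := fun j => a j * q n (m * x j + m * M))
      (fun j _ => hterm n x j) (Finset.mem_univ j)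
    rw [hR]
    dsimp only at h2 ⊢
    rw [p2, hcL]
    nlinarith [ha1 j, q1 n (m * x j + m * M)]
  have key := l1_small R (gridF g M m) (fun n => (hRc n).measurable) B (M + 1) ?_ ?_ ?_ ε hε
  · obtain ⟨n, hn⟩ := key
    exact ⟨R n, hRnet n, hRc n, hn⟩
  · intro n x
    rw [hR]
    exact p3 _ (Finset.sum_nonneg fun j _ => hterm n x j)
  · intro n x hx
    obtain ⟨j, hj⟩ := exists_coord x _ (by positivity) hx
    have h1 : 1 / ((n : ℝ) + 1) ≤ 1 := by
      rw [div_le_one (by positivity)]; linarith [(Nat.cast_nonneg n : (0 : ℝ) ≤ n)]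
    refine hout n x j ?_
    rcases hj with h | h
    · left; nlinarith
    · right; nlinarith
  · intro x
    unfold gridF
    rw [← hN]
    split_ifs with hx
    · obtain ⟨dg, hdg⟩ : ∃ dg : Fin d → Fin (N + 1), ∀ i, (dg i : ℕ) = ⌊(m : ℝ) * x i + m * M⌋₊ :=
        ⟨fun i => ⟨⌊(m : ℝ) * x i + m * M⌋₊, Nat.lt_succ_of_le (Nat.floor_le_of_le (hx i).2)⟩,
          fun i => rfl⟩
      have hlim : Tendsto (fun n => (∑ j, a j * q n (m * x j + m * M)) + (b + 1)) atTop
          (𝓝 ((∑ j, a j * ((dg j : ℕ) : ℝ)) + (b + 1))) := by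
        refine Tendsto.add_const _ (tendsto_finsetSum _ fun j _ => Tendsto.const_mul _ ?_)
        rw [hdg]
        exact q3 _ (hx j).1 (hx j).2
      have hk : (∑ j, a j * ((dg j : ℕ) : ℝ)) = ((finFunctionFinEquiv dg : ℕ) : ℝ) := by
        rw [finFunctionFinEquiv_apply, ha]
        push_cast
        exact Finset.sum_congr rfl fun j _ => mul_comm _ _
      have := (hp.continuous.tendsto _).comp hlim
      rw [hk, p1 _ (by rw [hL]; exact (finFunctionFinEquiv dg).2), hc] at this
      simp only [Fin.is_lt, dif_pos, Fin.eta, Equiv.symm_apply_apply, hdg] at this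
      rw [hR]
      exact this
    · push Not at hx
      obtain ⟨j, hj⟩ := hx
      have l0 := tendsto_one_div_add_atTop_nhds_zero_nat (𝕜 := ℝ)
      refine tendsto_const_nhds.congr' ?_
      rcases lt_or_ge ((m : ℝ) * x j + m * M) 0 with h | h
      · filter_upwards [l0.eventually_lt_const (u := -((m : ℝ) * x j + m * M)) (by linarith)] with n hn
        exact (hout n x j (Or.inl (by linarith))).symm
      · have := hj h
        filter_upwards [l0.eventually_lt_const (u := ((m : ℝ) * x j + m * M) - N) (by linarith)] with n hn
        exact (hout n x j (Or.inr (by linarith))).symm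

open MeasureTheory Filter Topology in
theorem gridF_measurable {d : ℕ} (g : (Fin d → ℝ) → ℝ) (hg : Continuous g) (M m : ℕ) :
    Measurable (gridF g M m) := by
  classical
  unfold gridF
  refine Measurable.ite ?_ ?_ measurable_const
  · have : {x : Fin d → ℝ | ∀ i, 0 ≤ (m : ℝ) * x i + m * M ∧
        (m : ℝ) * x i + m * M ≤ ((2 * M * m : ℕ) : ℝ)} = ⋂ i, {x : Fin d → ℝ |
        0 ≤ (m : ℝ) * x i + m * M ∧ (m : ℝ) * x i + m * M ≤ ((2 * M * m : ℕ) : ℝ)} := by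
      ext x; simp
    rw [this]
    refine MeasurableSet.iInter fun i => MeasurableSet.inter ?_ ?_
    · refine measurableSet_le (f := fun x : Fin d → ℝ => (0 : ℝ)) (g := fun x => (m : ℝ) * x i + m * M) ?_ ?_ <;> fun_prop
    · refine measurableSet_le (f := fun x : Fin d → ℝ => (m : ℝ) * x i + m * M) (g := fun _ => ((2 * M * m : ℕ) : ℝ)) ?_ ?_ <;> fun_prop
  · refine hg.measurable.comp (measurable_pi_lambda _ fun i => ?_)
    have : Measurable fun x : Fin d → ℝ => ⌊(m : ℝ) * x i + m * M⌋₊ :=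
      Nat.measurable_floor.comp (by fun_prop)
    have h2 : Measurable fun x : Fin d → ℝ => ((⌊(m : ℝ) * x i + m * M⌋₊ : ℕ) : ℝ) :=
      measurable_from_top.comp this
    exact (h2.div_const _).sub_const _

open MeasureTheory Filter Topology in
theorem grid_dense {d : ℕ} (g : (Fin d → ℝ) → ℝ) (hg : Continuous g) (b : ℝ)
    (hb : ∀ x, |g x| ≤ b) (M : ℕ) (hM : ∀ x, (M : ℝ) < ‖x‖ → g x = 0) (ε : ℝ) (hε : 0 < ε) :
    ∃ m : ℕ, 0 < m ∧ eLpNorm (fun x => g x - gridF g M m x) 1 volume ≤ ENNReal.ofReal ε := by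
  classical
  have hb0 : 0 ≤ b := (abs_nonneg _).trans (hb 0)
  have hz : ∀ (n : ℕ) (x : Fin d → ℝ), (M : ℝ) < ‖x‖ → gridF g M (n + 1) x = 0 := by
    intro n x hx
    obtain ⟨j, hj⟩ := exists_coord x _ (by positivity) hx
    unfold gridF
    rw [if_neg]
    intro hcon
    have h1 := hcon j
    push_cast at h1
    have hn : (0 : ℝ) < (n : ℝ) + 1 := by positivity
    rcases hj with h | h <;> nlinarith
  have key := l1_small (fun n => gridF g M (n + 1)) g
    (fun n => gridF_measurable g hg M _) b M ?_ hz ?_ ε hε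
  · obtain ⟨n, hn⟩ := key
    exact ⟨n + 1, n.succ_pos, hn⟩
  · intro n x
    unfold gridF
    split_ifs
    · exact hb _
    · simpa using hb0
  · intro x
    rcases lt_or_ge (M : ℝ) ‖x‖ with h | h
    · rw [hM x h]
      refine tendsto_const_nhds.congr fun n => (hz n x h).symm
    · have hx : ∀ i, -(M : ℝ) ≤ x i ∧ x i ≤ M := by
        intro i
        have := (norm_le_pi_norm x i).trans h
        rw [Real.norm_eq_abs, abs_le] at this
        exact this
      have hin : ∀ n : ℕ, ∀ i, 0 ≤ ((n + 1 : ℕ) : ℝ) * x i + ((n + 1 : ℕ) : ℝ) * M ∧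
          ((n + 1 : ℕ) : ℝ) * x i + ((n + 1 : ℕ) : ℝ) * M ≤ ((2 * M * (n + 1) : ℕ) : ℝ) := by
        intro n i
        have := hx i
        have hn : (0 : ℝ) < (n : ℝ) + 1 := by positivity
        push_cast
        constructor <;> nlinarith
      have e : ∀ n : ℕ, gridF g M (n + 1) x =
          g (fun i => ((⌊((n + 1 : ℕ) : ℝ) * x i + ((n + 1 : ℕ) : ℝ) * M⌋₊ : ℕ) : ℝ)
            / ((n + 1 : ℕ) : ℝ) - M) := by
        intro n
        unfold gridF
        rw [if_pos (hin n)]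
      simp only [e]
      refine (hg.tendsto x).comp (tendsto_pi_nhds.2 fun i => ?_)
      have l0 := tendsto_one_div_add_atTop_nhds_zero_nat (𝕜 := ℝ)
      have l1 : Tendsto (fun n : ℕ => x i - 1 / ((n : ℝ) + 1)) atTop (𝓝 (x i)) := by
        simpa using l0.const_sub (x i)
      refine tendsto_of_tendsto_of_tendsto_of_le_of_le l1 tendsto_const_nhds ?_ ?_
      · intro n
        have hn : (0 : ℝ) < (n : ℝ) + 1 := by positivity
        have := Nat.lt_floor_add_one (((n + 1 : ℕ) : ℝ) * x i + ((n + 1 : ℕ) : ℝ) * M)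
        push_cast at this ⊢
        try dsimp only
        rw [le_sub_iff_add_le, le_div_iff₀ hn]
        have e2 : 1 / ((n : ℝ) + 1) * (n + 1) = 1 := by field_simp
        linarith
      · intro n
        have hn : (0 : ℝ) < (n : ℝ) + 1 := by positivity
        have := Nat.floor_le (hin n i).1
        push_cast at this ⊢
        try dsimp only
        rw [sub_le_iff_le_add, div_le_iff₀ hn]
        linarith

/-- Every Lebesgue integrable `f : ℝ^d → ℝ` is approximated within `ε` in
`L¹(ℝ^d)` by a ReLU residual network with one neuron per hidden layer. -/
theorem stmt10 (d : ℕ) (hd : 0 < d)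
    (f : (Fin d → ℝ) → ℝ) (hf : MeasureTheory.Integrable f MeasureTheory.volume)
    (ε : ℝ) (hε : 0 < ε) :
    ∃ R : (Fin d → ℝ) → ℝ, IsResNet1 d R ∧
      MeasureTheory.eLpNorm (fun x => f x - R x) 1 MeasureTheory.volume ≤
        ENNReal.ofReal ε := by
  obtain ⟨g, gs, gf, gc, gm⟩ :=
    (MeasureTheory.memLp_one_iff_integrable.2 hf).exists_hasCompactSupport_eLpNorm_sub_le
      ENNReal.one_ne_top (ε := ENNReal.ofReal (ε / 3)) (by simpa using hε)
  obtain ⟨b, hb⟩ := gs.exists_bound_of_continuous gc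
  obtain ⟨r, hr⟩ := gs.isCompact.isBounded.subset_closedBall 0
  obtain ⟨M, hM⟩ := exists_nat_ge r
  have hM' : ∀ x, (M : ℝ) < ‖x‖ → g x = 0 := by
    intro x hx
    by_contra hne
    have := hr (subset_tsupport g hne)
    rw [mem_closedBall_zero_iff] at this
    linarith
  obtain ⟨m, hm, h2⟩ := grid_dense g gc b hb M hM' (ε / 3) (by linarith)
  obtain ⟨R, hR, hRc, h3⟩ := grid_approx hd g b hb M m hm (ε / 3) (by linarith)
  refine ⟨R, hR, ?_⟩
  have hG := gridF_measurable g gc M m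
  have e : (fun x => f x - R x) =
      (f - g) + ((fun x => g x - gridF g M m x) + fun x => gridF g M m x - R x) := by
    funext x
    simp
  have m1 : MeasureTheory.AEStronglyMeasurable (f - g) MeasureTheory.volume :=
    hf.aestronglyMeasurable.sub gc.aestronglyMeasurable
  have m2 : MeasureTheory.AEStronglyMeasurable (fun x => g x - gridF g M m x)
      MeasureTheory.volume := (gc.measurable.sub hG).aestronglyMeasurable
  have m3 : MeasureTheory.AEStronglyMeasurable (fun x => gridF g M m x - R x)
      MeasureTheory.volume := (hG.sub hRc.measurable).aestronglyMeasurable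
  rw [e]
  refine (MeasureTheory.eLpNorm_add_le m1 (m2.add m3) le_rfl).trans ?_
  refine (add_le_add gf ((MeasureTheory.eLpNorm_add_le m2 m3 le_rfl).trans
    (add_le_add h2 h3))).trans ?_
  rw [← ENNReal.ofReal_add (by linarith) (by linarith),
    ← ENNReal.ofReal_add (by linarith) (by linarith)]
  exact ENNReal.ofReal_le_ofReal (by linarith)

end
end
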